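/- arXiv:2401.07169 — 2 statements merged into one kernel-verified Lean document; each statement's English description precedes it below -/
import Mathlib

section
/- Let K be an algebraically closed field of characteristic p > 0, let q be a power of p, and let N ≥ 1. Let X ⊆ K^N be the zero locus of a set of polynomials in N variables with coefficients in K, and let Γ be a finitely generated subgroup of the multiplicative group (K^×)^N. Let S_q = {q^s : s ∈ ℤ, s ≥ 0}, a powers-closed subset of ℂ∖{0}. Then the set {γ ∈ Γ : γ ∈ X} is a finite union of multiplicative S_q-arithmetic sets in Γ (based in (K^×)^N). -/
open Pointwise

/-- A subset `S` of the complex numbers is powers-closed if for every `r ∈ S` and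
every integer `n ≥ 0`, we have `r ^ n ∈ S`. -/
def PowersClosed (S : Set ℂ) : Prop :=
  ∀ r ∈ S, ∀ n : ℕ, r ^ n ∈ S

/-- An `S`-arithmetic sequence: a sequence of integers whose terms (for `n ≥ 1`) are
given by `a n = ∑ i, d i * r i ^ n` for pairwise distinct `r_1, …, r_m ∈ S` and complex
numbers `d_1, …, d_m`. -/
def SArithSeq (S : Set ℂ) (a : ℕ → ℤ) : Prop :=
  ∃ (m : ℕ) (r : Fin m → ℂ) (d : Fin m → ℂ),
    Function.Injective r ∧ (∀ i, r i ∈ S) ∧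
    ∀ n : ℕ, 1 ≤ n → (a n : ℂ) = ∑ i, d i * r i ^ n

/-- A multiplicative `S`-arithmetic groupless set based in the (multiplicatively
written) abelian group `G`: a set of the form
`{∏ i, P i ^ a i (n i) : n_1, …, n_r ≥ 1}`. -/
def MulSArithGroupless (S : Set ℂ) {G : Type*} [CommGroup G] (U : Set G) : Prop :=
  ∃ (r : ℕ), 1 ≤ r ∧ ∃ (P : Fin r → G) (a : Fin r → ℕ → ℤ),
    (∀ i, SArithSeq S (a i)) ∧
    U = {x | ∃ n : Fin r → ℕ, (∀ i, 1 ≤ n i) ∧ x = ∏ i, P i ^ a i (n i)}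

/-- A multiplicative `S`-arithmetic set in the subgroup `Γ` (based in `G`):
a set of the form `U · B` where `U` is a multiplicative `S`-arithmetic groupless set
contained in `Γ` and `B` is a subgroup of `Γ`. -/
def MulSArithSetIn (S : Set ℂ) {G : Type*} [CommGroup G] (Γ : Subgroup G)
    (F : Set G) : Prop :=
  ∃ (U : Set G) (B : Subgroup G),
    MulSArithGroupless S U ∧ U ⊆ (Γ : Set G) ∧ B ≤ Γ ∧ F = U * (B : Set G)


theorem closure_image_eq_of_mapsTo {X : Type*} [TopologicalSpace X]
    [TopologicalSpace.NoetherianSpace X] {f : X → X} (hf : Topology.IsInducing f) {A : Set X}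
    (h : Set.MapsTo f A A) : closure (f '' A) = closure A := by
  have hn : ∀ n, Topology.IsInducing f^[n] := by
    intro n
    induction n with
    | zero => exact Topology.IsInducing.id
    | succ n ih => exact ih.comp hf
  have hstep : ∀ n, f^[n + 1] '' A = f^[n] '' (f '' A) := by
    intro n
    rw [← Set.image_comp]
    rfl
  have hsub : f '' A ⊆ A := h.image_subset
  obtain ⟨n, hstab⟩ := wellFoundedGT_iff_monotone_chain_condition.1
    (inferInstance : WellFoundedGT (TopologicalSpace.Closeds X)ᵒᵈ)
    ⟨fun n => OrderDual.toDual (⟨closure (f^[n] '' A), isClosed_closure⟩ :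
      TopologicalSpace.Closeds X), monotone_nat_of_le_succ fun n => by
        change closure (f^[n + 1] '' A) ⊆ closure (f^[n] '' A)
        rw [hstep]
        exact closure_mono (Set.image_mono hsub)⟩
  have h1 : closure (f^[n] '' A) = closure (f^[n + 1] '' A) :=
    congrArg (fun C : (TopologicalSpace.Closeds X)ᵒᵈ =>
      ((OrderDual.ofDual C : TopologicalSpace.Closeds X) : Set X)) (hstab (n + 1) n.le_succ)
  rw [(hn n).closure_eq_preimage_closure_image (f '' A), ← hstep, ← h1,
    ← (hn n).closure_eq_preimage_closure_image]

/-- The geometric sum `1 + Q + ⋯ + Q ^ (m - 1)`. -/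
def geomExp (Q m : ℕ) : ℕ := ∑ i ∈ Finset.range m, Q ^ i

theorem geomExp_zero (Q : ℕ) : geomExp Q 0 = 0 := by simp [geomExp]

theorem geomExp_add (Q m n : ℕ) : geomExp Q (m + n) = geomExp Q m + Q ^ m * geomExp Q n := by
  simp [geomExp, Finset.sum_range_add, Finset.mul_sum, pow_add]

theorem geomExp_succ (Q m : ℕ) : geomExp Q (m + 1) = 1 + Q * geomExp Q m := by
  rw [add_comm m, geomExp_add]
  simp [geomExp]

theorem pow_add_geomExp (Q m : ℕ) : Q ^ m + geomExp Q m = 1 + Q * geomExp Q m := by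
  rw [← geomExp_succ, geomExp_add]
  simp [geomExp, add_comm]

theorem finite_of_forall_mem_pow {A : Type*} [CommGroup A] [Group.FG A] {Q : ℕ} (hQ : 2 ≤ Q) :
    {x : A | ∀ m : ℕ, ∃ y : A, x = y ^ Q ^ m}.Finite := by
  have hfg : Module.Finite ℤ (Additive A) := Module.Finite.iff_addGroup_fg.2 inferInstance
  have htors : Finite (CommGroup.torsion A) := by
    have hfin : Module.Finite ℤ (Submodule.torsion ℤ (Additive A)) := inferInstance
    have := Module.finite_of_fg_torsion (Submodule.torsion ℤ (Additive A))
      (Submodule.torsion_isTorsion)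
    refine Finite.of_injective (fun x : CommGroup.torsion A =>
      (⟨Additive.ofMul x.1, ?_⟩ : Submodule.torsion ℤ (Additive A))) ?_
    · obtain ⟨n, hn, hx⟩ := isOfFinOrder_iff_pow_eq_one.1 x.2
      refine (Submodule.mem_torsion_iff _).2 ⟨⟨n, mem_nonZeroDivisors_of_ne_zero (by omega)⟩, ?_⟩
      change ((n : ℤ)) • Additive.ofMul x.1 = 0
      rw [natCast_zsmul, ← ofMul_pow, hx, ofMul_one]
    · intro x y hxy
      exact Subtype.ext (congrArg (fun z => z.1.toMul) hxy)
  refine (Set.toFinite (CommGroup.torsion A : Set A)).subset fun x hx => ?_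
  have hmem : Additive.ofMul x ∈
      (⨅ i : ℕ, (Ideal.span {(Q : ℤ)}) ^ i • ⊤ : Submodule ℤ (Additive A)) := by
    rw [Submodule.mem_iInf]
    intro m
    obtain ⟨y, rfl⟩ := hx m
    rw [Ideal.span_singleton_pow, ofMul_pow, ← natCast_zsmul]
    refine Submodule.smul_mem_smul ?_ Submodule.mem_top
    rw [Ideal.mem_span_singleton]
    push_cast
    exact dvd_rfl
  obtain ⟨⟨r, hr⟩, hrx⟩ := (Ideal.mem_iInf_smul_pow_eq_bot_iff _ _).1 hmem
  obtain ⟨k, rfl⟩ := Ideal.mem_span_singleton.1 hr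
  have h0 : (Q : ℤ) * k - 1 ≠ 0 := by
    intro h
    have : (Q : ℤ) ∣ 1 := ⟨k, by linarith⟩
    have := Int.le_of_dvd one_pos this
    omega
  refine isOfFinOrder_iff_zpow_eq_one.2 ⟨_, h0, ?_⟩
  apply Additive.ofMul.injective
  rw [ofMul_zpow, sub_smul, one_smul, hrx, sub_self, ofMul_one]

/-- The products `∏ c ^ geomExp Q n_c` over the entries `c` of a list, with all `n_c ≥ M`. -/
def orbitSet {G : Type*} [CommGroup G] (Q M : ℕ) : List G → Set G
  | [] => {1}
  | c :: l => {x | ∃ n, M ≤ n ∧ ∃ y ∈ orbitSet Q M l, x = c ^ geomExp Q n * y}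

/-- A translate of an orbit set by a subgroup. -/
def orbitPiece {G : Type*} [CommGroup G] (Q : ℕ) (c : G) (l : List G) (H : Subgroup G) : Set G :=
  {x | ∃ y ∈ orbitSet Q 0 l, ∃ h ∈ H, x = c * y * h}

/-- Finite unions of translates of orbit sets by subgroups. -/
def IsOrbitUnion {G : Type*} [CommGroup G] (Q : ℕ) (S : Set G) : Prop :=
  ∃ 𝓟 : Set (Set G), 𝓟.Finite ∧ (∀ P ∈ 𝓟, ∃ c l H, P = orbitPiece Q c l H) ∧ S = ⋃₀ 𝓟

section OrbitSets

variable {G : Type*} [CommGroup G] {Q : ℕ}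

theorem IsOrbitUnion.biUnion {ι : Type*} {s : Set ι} (hs : s.Finite) {f : ι → Set G}
    (h : ∀ i ∈ s, IsOrbitUnion Q (f i)) : IsOrbitUnion Q (⋃ i ∈ s, f i) := by
  choose! 𝓟 h1 h2 h3 using h
  refine ⟨⋃ i ∈ s, 𝓟 i, hs.biUnion h1, ?_, ?_⟩
  · intro P hP
    obtain ⟨i, hi, hP⟩ := Set.mem_iUnion₂.1 hP
    exact h2 i hi P hP
  · ext x
    simp only [Set.mem_iUnion, Set.mem_sUnion, exists_prop]
    constructor
    · rintro ⟨i, hi, hx⟩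
      rw [h3 i hi] at hx
      obtain ⟨P, hP, hx⟩ := hx
      exact ⟨P, ⟨i, hi, hP⟩, hx⟩
    · rintro ⟨P, ⟨i, hi, hP⟩, hx⟩
      refine ⟨i, hi, ?_⟩
      rw [h3 i hi]
      exact ⟨P, hP, hx⟩

theorem image_pow_orbitSet (k : ℕ) (l : List G) :
    (fun x => x ^ k) '' orbitSet Q 0 l = orbitSet Q 0 (l.map fun x => x ^ k) := by
  induction l with
  | nil => simp [orbitSet]
  | cons c l ih =>
    ext x
    simp only [orbitSet, List.map_cons, ← ih]
    constructor
    · rintro ⟨_, ⟨n, hn, y, hy, rfl⟩, rfl⟩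
      exact ⟨n, hn, _, ⟨y, hy, rfl⟩, by simp only [mul_pow, pow_right_comm]⟩
    · rintro ⟨n, hn, _, ⟨y, hy, rfl⟩, rfl⟩
      exact ⟨_, ⟨n, hn, y, hy, rfl⟩, by simp only [mul_pow, pow_right_comm]⟩

theorem image_orbitPiece (g : G) (k : ℕ) (c : G) (l : List G) (H : Subgroup G) :
    (fun x => g * x ^ k) '' orbitPiece Q c l H =
      orbitPiece Q (g * c ^ k) (l.map fun x => x ^ k) (H.map (powMonoidHom k)) := by
  ext x
  simp only [orbitPiece, ← image_pow_orbitSet]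
  constructor
  · rintro ⟨_, ⟨y, hy, h, hh, rfl⟩, rfl⟩
    refine ⟨_, ⟨y, hy, rfl⟩, h ^ k, ⟨h, hh, rfl⟩, ?_⟩
    simp only [mul_pow, mul_assoc]
  · rintro ⟨_, ⟨y, hy, rfl⟩, _, ⟨h, hh, rfl⟩, rfl⟩
    refine ⟨_, ⟨y, hy, h, hh, rfl⟩, ?_⟩
    simp only [mul_pow, mul_assoc, powMonoidHom_apply]

theorem IsOrbitUnion.image {S : Set G} (h : IsOrbitUnion Q S) (g : G) (k : ℕ) :
    IsOrbitUnion Q ((fun x => g * x ^ k) '' S) := by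
  obtain ⟨𝓟, h1, h2, rfl⟩ := h
  refine ⟨Set.image (fun x => g * x ^ k) '' 𝓟, h1.image _, ?_, Set.image_sUnion ..⟩
  rintro _ ⟨P, hP, rfl⟩
  obtain ⟨c, l, H, rfl⟩ := h2 P hP
  exact ⟨_, _, _, image_orbitPiece ..⟩

theorem orbitSet_pow_mem {l : List G} {x : G} (hx : x ∈ orbitSet Q 0 l) (m : ℕ) :
    x ^ Q ^ m * l.prod ^ geomExp Q m ∈ orbitSet Q m l := by
  induction l generalizing x with
  | nil =>
    rw [orbitSet, Set.mem_singleton_iff] at hx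
    simp [hx, orbitSet]
  | cons c l ih =>
    obtain ⟨n, -, y, hy, rfl⟩ := hx
    refine ⟨m + n, by omega, _, ih hy, ?_⟩
    rw [geomExp_add, List.prod_cons, mul_pow, mul_pow, pow_add, ← pow_mul, mul_comm (Q ^ m)]
    simp only [mul_left_comm, mul_assoc]

theorem exists_pow_mem_of_mem_orbitSet {l : List G} {x : G} {m : ℕ} (hx : x ∈ orbitSet Q m l) :
    ∃ y ∈ orbitSet Q 0 l, x = y ^ Q ^ m * l.prod ^ geomExp Q m := by
  induction l generalizing x with
  | nil =>
    rw [orbitSet, Set.mem_singleton_iff] at hx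
    exact ⟨1, rfl, by simp [hx]⟩
  | cons c l ih =>
    obtain ⟨n, hn, y, hy, rfl⟩ := hx
    obtain ⟨y, hy', rfl⟩ := ih hy
    obtain ⟨n, rfl⟩ := Nat.exists_eq_add_of_le hn
    refine ⟨_, ⟨n, by omega, y, hy', rfl⟩, ?_⟩
    rw [geomExp_add, List.prod_cons, mul_pow, mul_pow, pow_add, ← pow_mul, mul_comm (Q ^ m)]
    simp only [mul_left_comm, mul_assoc]

theorem orbitSet_antitone {m n : ℕ} (hmn : m ≤ n) (l : List G) :
    orbitSet Q n l ⊆ orbitSet Q m l := by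
  induction l with
  | nil => exact subset_rfl
  | cons c l ih =>
    rintro _ ⟨k, hk, y, hy, rfl⟩
    exact ⟨k, hmn.trans hk, y, ih hy, rfl⟩

variable [TopologicalSpace G] [TopologicalSpace.NoetherianSpace G] {p : ℕ}

theorem mem_of_eventually_mem_closed
    (hI : ∀ (g : G) (k : ℕ), Topology.IsInducing fun y => g * y ^ p ^ k)
    {C : Set G} (hC : IsClosed C) {b c : G} {a M : ℕ}
    (h : ∀ n, M ≤ n → b * c ^ geomExp (p ^ a) n ∈ C) (n : ℕ) : b * c ^ geomExp (p ^ a) n ∈ C := by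
  set A : Set G := Set.range fun n => c ^ geomExp (p ^ a) n
  set f : G → G := fun y => c ^ geomExp (p ^ a) M * y ^ p ^ (a * M)
  have hf : ∀ n, f (c ^ geomExp (p ^ a) n) = c ^ geomExp (p ^ a) (M + n) := by
    intro n
    simp only [f]
    rw [geomExp_add, pow_add, ← pow_mul, ← pow_mul, mul_comm (geomExp _ n)]
  have hA : Set.MapsTo f A A := by
    rintro _ ⟨n, rfl⟩
    exact ⟨M + n, (hf n).symm⟩
  have hcl := closure_image_eq_of_mapsTo (hI _ _) hA
  have hC' : IsClosed ((fun y => b * y) ⁻¹' C) :=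
    hC.preimage (by simpa using (hI b 0).continuous)
  have hsub : closure (f '' A) ⊆ (fun y => b * y) ⁻¹' C := by
    refine hC'.closure_subset_iff.2 ?_
    rintro _ ⟨_, ⟨n, rfl⟩, rfl⟩
    rw [Set.mem_preimage, hf]
    exact h _ (by omega)
  rw [hcl] at hsub
  exact hsub (subset_closure ⟨n, rfl⟩)

theorem orbitSet_subset_of_closed
    (hI : ∀ (g : G) (k : ℕ), Topology.IsInducing fun y => g * y ^ p ^ k)
    {C : Set G} (hC : IsClosed C) {b : G} {l : List G} {a M : ℕ}
    (h : ∀ x ∈ orbitSet (p ^ a) M l, b * x ∈ C) : ∀ x ∈ orbitSet (p ^ a) 0 l, b * x ∈ C := by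
  induction l generalizing b with
  | nil => exact h
  | cons c l ih =>
    rintro _ ⟨n, -, x, hx, rfl⟩
    rw [mul_comm (c ^ _), ← mul_assoc]
    refine mem_of_eventually_mem_closed hI hC (M := M) (fun n hn => ?_) n
    rw [mul_assoc, mul_comm x, ← mul_assoc]
    refine ih (fun y hy => ?_) x hx
    rw [mul_assoc]
    exact h _ ⟨n, hn, y, hy, rfl⟩

theorem mul_subgroup_mem_of_closed
    (hI : ∀ (g : G) (k : ℕ), Topology.IsInducing fun y => g * y ^ p ^ k)
    {C : Set G} (hC : IsClosed C) {b : G} {H : Subgroup G} {k : ℕ}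
    (h : ∀ x ∈ H, b * x ^ p ^ k ∈ C) : ∀ x ∈ H, b * x ∈ C := by
  have hcl := closure_image_eq_of_mapsTo (f := fun y : G => 1 * y ^ p ^ k) (hI 1 k)
    (A := (H : Set G)) (fun x hx => by simpa using H.pow_mem hx _)
  have hC' : IsClosed ((fun y => b * y) ⁻¹' C) :=
    hC.preimage (by simpa using (hI b 0).continuous)
  have hsub : closure ((fun y : G => 1 * y ^ p ^ k) '' (H : Set G)) ⊆ (fun y => b * y) ⁻¹' C := by
    refine hC'.closure_subset_iff.2 ?_
    rintro _ ⟨x, hx, rfl⟩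
    simpa using h x hx
  rw [hcl] at hsub
  exact fun x hx => hsub (subset_closure hx)

end OrbitSets

section Step

variable {G : Type*} [CommGroup G]

theorem pow_geomExp_mul_mem_iff {S : Set G} {γ : G} {Q : ℕ}
    (hT : ∀ y, γ * y ^ Q ∈ S ↔ y ∈ S) (m : ℕ) (y : G) :
    γ ^ geomExp Q m * y ^ Q ^ m ∈ S ↔ y ∈ S := by
  induction m generalizing y with
  | zero => simp [geomExp_zero]
  | succ m ih =>
    rw [← ih y, ← hT (γ ^ geomExp Q m * y ^ Q ^ m), geomExp_succ, pow_succ Q, mul_pow, ← pow_mul,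
      ← pow_mul, pow_add, pow_one, mul_comm Q, mul_assoc]

theorem exists_pow_geomExp_or {S E B : Set G} {γ : G} {Q : ℕ}
    (hB1 : (1 : G) ∈ B) (hBm : ∀ x ∈ B, ∀ y ∈ B, x * y ∈ B) (hBp : ∀ x ∈ B, ∀ n : ℕ, x ^ n ∈ B)
    (hcov : ∀ x ∈ S, x ∈ E ∨ ∃ y ∈ S, ∃ b ∈ B, x = γ * y ^ Q * b) (m : ℕ) :
    ∀ x ∈ S, (∃ j, ∃ y ∈ E, ∃ b ∈ B, x = γ ^ geomExp Q j * y ^ Q ^ j * b) ∨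
      ∃ y ∈ S, ∃ b ∈ B, x = γ ^ geomExp Q m * y ^ Q ^ m * b := by
  induction m with
  | zero => exact fun x hx => Or.inr ⟨x, hx, 1, hB1, by simp [geomExp_zero]⟩
  | succ m ih =>
    intro x hx
    rcases ih x hx with h | ⟨y, hy, b, hb, rfl⟩
    · exact Or.inl h
    · rcases hcov y hy with h | ⟨z, hz, b', hb', rfl⟩
      · exact Or.inl ⟨m, y, h, b, hb, rfl⟩
      · refine Or.inr ⟨z, hz, b' ^ Q ^ m * b, hBm _ (hBp _ hb' _) _ hb, ?_⟩
        have : geomExp Q (m + 1) = geomExp Q m + Q ^ m := by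
          rw [geomExp_succ, ← pow_add_geomExp, add_comm]
        rw [this, mul_pow, mul_pow, ← pow_mul, pow_succ' Q, pow_add]
        simp only [mul_assoc]

theorem mul_div_geomExp (Q m : ℕ) (γ c u y : G) :
    c * ((γ * c ^ Q / (c * u)) ^ geomExp Q m * (y ^ Q ^ m * u ^ geomExp Q m)) =
      γ ^ geomExp Q m * (c * y) ^ Q ^ m := by
  have e1 : c ^ Q ^ m * c ^ geomExp Q m = c * (c ^ Q) ^ geomExp Q m := by
    rw [← pow_add, pow_add_geomExp, pow_add, pow_one, pow_mul]
  rw [div_pow, mul_pow, mul_pow, mul_pow, div_eq_mul_inv, mul_inv]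
  have e2 := mul_inv_cancel (u ^ geomExp Q m)
  have e3 := mul_inv_cancel (c ^ geomExp Q m)
  generalize u ^ geomExp Q m = u at *
  generalize c ^ geomExp Q m = v at *
  calc _ = (c * (c ^ Q) ^ geomExp Q m) * v⁻¹ * (u * u⁻¹) * γ ^ geomExp Q m * y ^ Q ^ m := by
        simp only [mul_comm, mul_left_comm, mul_assoc]
    _ = c ^ Q ^ m * (v * v⁻¹) * (u * u⁻¹) * γ ^ geomExp Q m * y ^ Q ^ m := by
        rw [← e1]
        simp only [mul_comm, mul_left_comm, mul_assoc]
    _ = _ := by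
        rw [e2, e3]
        simp only [mul_one, mul_comm, mul_assoc]

theorem pow_geomExp_mul_mem_orbitPiece {Q : ℕ} {γ c z h b : G} {l : List G} {H B : Subgroup G}
    (hz : z ∈ orbitSet Q 0 l) (hh : h ∈ H) (hb : b ∈ B) (j : ℕ) :
    γ ^ geomExp Q j * (c * z * h) ^ Q ^ j * b ∈
      orbitPiece Q c ((γ * c ^ Q / (c * l.prod)) :: l) (H ⊔ B) := by
  refine ⟨_, ⟨j, Nat.zero_le _, _, orbitSet_antitone (Nat.zero_le _) l (orbitSet_pow_mem hz j),
    rfl⟩, h ^ Q ^ j * b, Subgroup.mul_mem_sup (H.pow_mem hh _) hb, ?_⟩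
  rw [mul_div_geomExp, mul_pow (c * z)]
  simp only [mul_assoc]

variable [TopologicalSpace G] [TopologicalSpace.NoetherianSpace G] {p : ℕ}

theorem orbitPiece_cons_subset
    (hI : ∀ (g : G) (k : ℕ), Topology.IsInducing fun y => g * y ^ p ^ k)
    {S : Set G} (hS : IsClosed S) {γ : G} {a : ℕ}
    (hT : ∀ y, γ * y ^ p ^ a ∈ S ↔ y ∈ S) {c : G} {l : List G} {H : Subgroup G}
    (hP : orbitPiece (p ^ a) c l H ⊆ S) :
    orbitPiece (p ^ a) c ((γ * c ^ p ^ a / (c * l.prod)) :: l)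
      (H ⊔ MulAction.stabilizer G S) ⊆ S := by
  set g := γ * c ^ p ^ a / (c * l.prod) with hg
  have key : ∀ h ∈ H, ∀ m, ∀ x ∈ orbitSet (p ^ a) m l,
      (h * c * g ^ geomExp (p ^ a) m) * x ∈ S := by
    intro h hh m x hx
    obtain ⟨y, hy, rfl⟩ := exists_pow_mem_of_mem_orbitSet hx
    have := mul_subgroup_mem_of_closed hI hS (k := a * m)
      (b := γ ^ geomExp (p ^ a) m * (c * y) ^ (p ^ a) ^ m) (H := H) (fun h hh => by
        rw [pow_mul, mul_assoc, ← mul_pow, pow_geomExp_mul_mem_iff hT]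
        exact hP ⟨y, hy, h, hh, rfl⟩) h hh
    rw [mul_assoc h, mul_assoc h, mul_assoc c, mul_div_geomExp, mul_comm]
    exact this
  rintro _ ⟨_, ⟨n, -, x, hx, rfl⟩, h, hh, rfl⟩
  obtain ⟨h', hh', b, hb, rfl⟩ := Subgroup.mem_sup.1 hh
  have h1 := mem_of_eventually_mem_closed hI hS (a := a) (M := 0) (b := h' * c * x) (c := g)
    (fun n _ => by
      have := orbitSet_subset_of_closed hI hS (M := n) (a := a) (key h' hh' n) x hx
      rwa [mul_right_comm] at this) n
  rw [← MulAction.mem_stabilizer_set.1 hb, smul_eq_mul] at h1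
  convert h1 using 1
  simp only [mul_comm, mul_left_comm, mul_assoc]

theorem isOrbitUnion_of_step [Group.FG G] (hp : 2 ≤ p)
    (hI : ∀ (g : G) (k : ℕ), Topology.IsInducing fun y => g * y ^ p ^ k)
    {S E : Set G} (hS : IsClosed S) {γ : G} {a : ℕ} (ha : 1 ≤ a)
    (hT : ∀ y, γ * y ^ p ^ a ∈ S ↔ y ∈ S) (hE : IsOrbitUnion (p ^ a) E) (hES : E ⊆ S)
    (hcov : ∀ x ∈ S, x ∈ E ∨ ∃ y ∈ S, ∃ b ∈ MulAction.stabilizer G S, x = γ * y ^ p ^ a * b) :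
    IsOrbitUnion (p ^ a) S := by
  set B := MulAction.stabilizer G S
  set Q := p ^ a
  have hQ : 2 ≤ Q := hp.trans (Nat.le_self_pow (by omega) p)
  set X : Set G := {x | x ∈ S ∧ ∀ m, ∃ y, ∃ b ∈ B, x = γ ^ geomExp Q m * y ^ Q ^ m * b}
  have hX : ((fun x : G => (x : G ⧸ B)) '' X).Finite := by
    rcases X.eq_empty_or_nonempty with h | ⟨x₀, hx₀⟩
    · simp [h]
    · refine ((finite_of_forall_mem_pow (A := G ⧸ B) hQ).image
        fun y => (x₀ : G ⧸ B) * y).subset ?_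
      rintro _ ⟨x, hx, rfl⟩
      refine ⟨(x₀ : G ⧸ B)⁻¹ * x, fun m => ?_, mul_inv_cancel_left _ _⟩
      obtain ⟨y, b, hb, h⟩ := hx.2 m
      obtain ⟨y₀, b₀, hb₀, h₀⟩ := hx₀.2 m
      have h' := congrArg (QuotientGroup.mk (s := B)) h
      have h₀' := congrArg (QuotientGroup.mk (s := B)) h₀
      rw [QuotientGroup.mk_mul_of_mem _ hb, QuotientGroup.mk_mul, QuotientGroup.mk_pow (N := B) y]
        at h'
      rw [QuotientGroup.mk_mul_of_mem _ hb₀, QuotientGroup.mk_mul,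
        QuotientGroup.mk_pow (N := B) y₀] at h₀'
      refine ⟨(y₀ : G ⧸ B)⁻¹ * y, ?_⟩
      rw [h', h₀', mul_pow, mul_inv, inv_pow, mul_mul_mul_comm, inv_mul_cancel, one_mul]
  obtain ⟨𝓟, hfin, hpc, rfl⟩ := hE
  choose! c l H hcl using hpc
  set f : Set G → Set G := fun P =>
    orbitPiece Q (c P) ((γ * c P ^ Q / (c P * (l P).prod)) :: l P) (H P ⊔ B)
  refine ⟨f '' 𝓟 ∪ (fun z : G ⧸ B => {x : G | (x : G ⧸ B) = z}) ''
    ((fun x : G => (x : G ⧸ B)) '' X), (hfin.image f).union (hX.image _), ?_, ?_⟩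
  · rintro _ (⟨P, hP, rfl⟩ | ⟨_, ⟨x, hx, rfl⟩, rfl⟩)
    · exact ⟨_, _, _, rfl⟩
    · refine ⟨x, [], B, ?_⟩
      ext y
      simp only [Set.mem_ofPred_eq, orbitPiece, orbitSet, Set.mem_singleton_iff, exists_eq_left,
        mul_one]
      rw [eq_comm, QuotientGroup.eq]
      exact ⟨fun h => ⟨_, h, by simp⟩, fun ⟨b, hb, h⟩ => by simpa [h] using hb⟩
  · ext x
    constructor
    · intro hx
      by_cases hxX : x ∈ X
      · exact ⟨_, Or.inr ⟨_, ⟨x, hxX, rfl⟩, rfl⟩, rfl⟩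
      · have : ∃ m, ∀ y, ∀ b ∈ B, x ≠ γ ^ geomExp Q m * y ^ Q ^ m * b := by
          by_contra! hcon
          exact hxX ⟨hx, hcon⟩
        obtain ⟨m, hm⟩ := this
        rcases exists_pow_geomExp_or (B := (B : Set G)) B.one_mem (fun x hx y hy => B.mul_mem hx hy)
          (fun x hx n => B.pow_mem hx n) hcov m x hx with
          ⟨j, y, ⟨P, hP, hy⟩, b, hb, rfl⟩ | ⟨y, -, b, hb, h⟩
        · refine ⟨f P, Or.inl ⟨P, hP, rfl⟩, ?_⟩
          rw [hcl P hP] at hy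
          obtain ⟨z, hz, h, hh, rfl⟩ := hy
          exact pow_geomExp_mul_mem_orbitPiece hz hh hb j
        · exact absurd h (hm y b hb)
    · rintro ⟨_, ⟨P, hP, rfl⟩ | ⟨_, ⟨y, hy, rfl⟩, rfl⟩, hx⟩
      · refine orbitPiece_cons_subset hI hS hT ?_ hx
        rw [← hcl P hP]
        exact (Set.subset_sUnion_of_mem hP).trans hES
      · have hx' : y⁻¹ * x ∈ B := QuotientGroup.eq.1 hx.symm
        have := (MulAction.mem_stabilizer_set.1 hx' y).2 hy.1
        simpa using this

end Step

/-- Representatives modulo `p ^ n`-th powers built from a set `R` of representatives modulo `p`-th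
powers. -/
def powReps {G : Type*} [CommGroup G] (p : ℕ) (R : Set G) : ℕ → Set G
  | 0 => {1}
  | n + 1 => {x | ∃ r ∈ R, ∃ s ∈ powReps p R n, x = r * s ^ p}

/-- The section of `S` by `γ` at level `n`. -/
def powSection {G : Type*} [CommGroup G] (p n : ℕ) (γ : G) (S : Set G) : Set G :=
  {y | γ * y ^ p ^ n ∈ S}

section Automaton

variable {G : Type*} [CommGroup G] {p : ℕ} {R : Set G}

theorem powSection_powSection (n m : ℕ) (γ δ : G) (S : Set G) :
    powSection p m δ (powSection p n γ S) = powSection p (n + m) (γ * δ ^ p ^ n) S := by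
  ext y
  simp only [powSection, Set.mem_ofPred_eq]
  rw [mul_pow, ← pow_mul, ← pow_add, mul_assoc, add_comm m]

theorem powReps_finite (hR : R.Finite) (n : ℕ) : (powReps p R n).Finite := by
  induction n with
  | zero => exact Set.finite_singleton _
  | succ n ih =>
    refine (Set.Finite.image2 (fun r s => r * s ^ p) hR ih).subset ?_
    rintro _ ⟨r, hr, s, hs, rfl⟩
    exact ⟨r, hr, s, hs, rfl⟩

theorem exists_powReps (hR : ∀ x : G, ∃ r ∈ R, ∃ y, x = r * y ^ p) (n : ℕ) (x : G) :
    ∃ γ ∈ powReps p R n, ∃ y, x = γ * y ^ p ^ n := by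
  induction n generalizing x with
  | zero => exact ⟨1, rfl, x, by simp⟩
  | succ n ih =>
    obtain ⟨r, hr, y, rfl⟩ := hR x
    obtain ⟨s, hs, z, rfl⟩ := ih y
    exact ⟨_, ⟨r, hr, s, hs, rfl⟩, z, by rw [mul_pow, ← pow_mul, pow_succ, mul_assoc]⟩

theorem mul_mem_powReps {n m : ℕ} {γ δ : G} (hγ : γ ∈ powReps p R n) (hδ : δ ∈ powReps p R m) :
    γ * δ ^ p ^ n ∈ powReps p R (n + m) := by
  induction n generalizing γ with
  | zero =>
    rw [powReps, Set.mem_singleton_iff] at hγ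
    simpa [hγ] using hδ
  | succ n ih =>
    obtain ⟨r, hr, s, hs, rfl⟩ := hγ
    rw [add_right_comm]
    exact ⟨r, hr, _, ih hs, by rw [mul_pow, ← pow_mul, pow_succ, mul_assoc]⟩

theorem powSection_mem {𝒮 : Set (Set G)}
    (hsec : ∀ S ∈ 𝒮, ∀ r ∈ R, {y | r * y ^ p ∈ S} ∈ 𝒮) {n : ℕ} {γ : G}
    (hγ : γ ∈ powReps p R n) {S : Set G} (hS : S ∈ 𝒮) : powSection p n γ S ∈ 𝒮 := by
  induction n generalizing γ S with
  | zero =>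
    rw [powReps, Set.mem_singleton_iff] at hγ
    simpa [hγ, powSection] using hS
  | succ n ih =>
    obtain ⟨r, hr, s, hs, rfl⟩ := hγ
    have := ih hs (hsec S hS r hr)
    convert this using 1
    ext y
    simp only [powSection, Set.mem_ofPred_eq]
    rw [mul_pow, ← pow_mul, pow_succ, mul_assoc]

theorem pow_geomExp_mem_powReps {n : ℕ} {γ : G} (hγ : γ ∈ powReps p R n) (k : ℕ) :
    γ ^ geomExp (p ^ n) k ∈ powReps p R (n * k) := by
  induction k with
  | zero => simp [geomExp_zero, powReps]
  | succ k ih =>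
    have := mul_mem_powReps hγ ih
    rwa [geomExp_succ, pow_add, pow_one, mul_comm (p ^ n), pow_mul, mul_add, mul_one, add_comm]

theorem powSection_pow_geomExp {n : ℕ} {γ : G} {S : Set G} (h : powSection p n γ S = S) (k : ℕ) :
    powSection p (n * k) (γ ^ geomExp (p ^ n) k) S = S := by
  ext y
  simp only [powSection, Set.mem_ofPred_eq]
  rw [pow_mul]
  exact pow_geomExp_mul_mem_iff (fun y => Set.ext_iff.1 h y) k y

/-- `T` is reached from `S` by taking sections. -/
def SectionReach {G : Type*} [CommGroup G] (p : ℕ) (R : Set G) (S T : Set G) : Prop :=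
  ∃ n, ∃ γ ∈ powReps p R n, powSection p n γ S = T

theorem SectionReach.trans {S T U : Set G} (h : SectionReach p R S T) (h' : SectionReach p R T U) :
    SectionReach p R S U := by
  obtain ⟨n, γ, hγ, rfl⟩ := h
  obtain ⟨m, δ, hδ, rfl⟩ := h'
  exact ⟨_, _, mul_mem_powReps hγ hδ, (powSection_powSection ..).symm⟩

theorem SectionReach.refl (S : Set G) : SectionReach p R S S :=
  ⟨0, 1, rfl, by simp [powSection]⟩

theorem exists_uniform_loop_length {𝒮 : Set (Set G)} (hfin : 𝒮.Finite) {e : ℕ} (he : 1 ≤ e) :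
    ∃ a, 1 ≤ a ∧ e ∣ a ∧ ∀ S ∈ 𝒮, (∃ n, 1 ≤ n ∧ ∃ γ ∈ powReps p R n, powSection p n γ S = S) →
      ∃ γ ∈ powReps p R a, powSection p a γ S = S := by
  classical
  have hℓ : ∀ S : Set G, ∃ n, 1 ≤ n ∧
      ((∃ n, 1 ≤ n ∧ ∃ γ ∈ powReps p R n, powSection p n γ S = S) →
        ∃ γ ∈ powReps p R n, powSection p n γ S = S) := by
    intro S
    by_cases h : ∃ n, 1 ≤ n ∧ ∃ γ ∈ powReps p R n, powSection p n γ S = S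
    · obtain ⟨n, hn, h'⟩ := h
      exact ⟨n, hn, fun _ => h'⟩
    · exact ⟨1, le_rfl, fun h' => absurd h' h⟩
  choose ℓ hℓ1 hℓ2 using hℓ
  refine ⟨e * ∏ S ∈ hfin.toFinset, ℓ S, ?_, dvd_mul_right _ _, fun S hS h => ?_⟩
  · exact Nat.mul_pos he (Finset.prod_pos fun S _ => hℓ1 S)
  · obtain ⟨γ, hγ, h⟩ := hℓ2 S h
    obtain ⟨k, hk⟩ : ℓ S ∣ e * ∏ S ∈ hfin.toFinset, ℓ S :=
      (Finset.dvd_prod_of_mem ℓ (hfin.mem_toFinset.2 hS)).mul_left e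
    rw [hk]
    exact ⟨_, pow_geomExp_mem_powReps hγ k, powSection_pow_geomExp h k⟩

variable [TopologicalSpace G] [TopologicalSpace.NoetherianSpace G]

theorem closure_image_eq_of_powSection
    (hI : ∀ (g : G) (k : ℕ), Topology.IsInducing fun y => g * y ^ p ^ k)
    {S : Set G} (hS : IsClosed S) {n : ℕ} {γ : G} (h : powSection p n γ S = S) :
    closure ((fun y => γ * y ^ p ^ n) '' S) = S := by
  rw [closure_image_eq_of_mapsTo (hI γ n) (A := S), hS.closure_eq]
  exact fun y hy => (Set.ext_iff.1 h y).2 hy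

theorem div_mem_stabilizer_of_powSection
    (hI : ∀ (g : G) (k : ℕ), Topology.IsInducing fun y => g * y ^ p ^ k)
    {S : Set G} (hS : IsClosed S) {n : ℕ} {γ δ : G} (h : powSection p n γ S = S)
    (h' : powSection p n δ S = S) : γ / δ ∈ MulAction.stabilizer G S := by
  have hcont : ∀ g : G, Continuous fun y => g * y := fun g => by
    simpa using (hI g 0).continuous
  have key : ∀ {γ δ : G}, powSection p n γ S = S → powSection p n δ S = S →
      ∀ x ∈ S, γ / δ * x ∈ S := by
    intro γ δ h h' x hx
    have hsub : closure ((fun y => δ * y ^ p ^ n) '' S) ⊆ (fun y => γ / δ * y) ⁻¹' S := by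
      refine (hS.preimage (hcont _)).closure_subset_iff.2 ?_
      rintro _ ⟨y, hy, rfl⟩
      have := (Set.ext_iff.1 h y).2 hy
      simpa [powSection, ← mul_assoc] using this
    rw [closure_image_eq_of_powSection hI hS h'] at hsub
    exact hsub hx
  rw [MulAction.mem_stabilizer_set]
  intro x
  refine ⟨fun hx => ?_, key h h' x⟩
  have := key h' h _ hx
  rwa [smul_eq_mul, ← mul_assoc, div_mul_div_cancel, div_self', one_mul] at this

theorem exists_stabilizer_of_returning
    (hI : ∀ (g : G) (k : ℕ), Topology.IsInducing fun y => g * y ^ p ^ k)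
    {S : Set G} (hS : IsClosed S) {a : ℕ} (ha : 1 ≤ a) {γ₀ γ : G} (h₀ : powSection p a γ₀ S = S)
    (hret : SectionReach p R (powSection p a γ S) S) :
    ∃ b ∈ MulAction.stabilizer G S, ∃ z, γ = γ₀ * z ^ p ^ a * b := by
  obtain ⟨m, δ, -, hm⟩ := hret
  rw [powSection_powSection] at hm
  have h1 := powSection_pow_geomExp hm a
  have h2 := powSection_pow_geomExp h₀ (a + m)
  rw [mul_comm] at h2
  have h3 := div_mem_stabilizer_of_powSection hI hS h1 h2
  have hw : ∃ w, (γ * δ ^ p ^ a) ^ geomExp (p ^ (a + m)) a = γ * w ^ p ^ a := by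
    obtain ⟨k, hk⟩ := Nat.exists_eq_add_of_le' ha
    refine ⟨δ * (γ * δ ^ p ^ a) ^ (p ^ m * geomExp (p ^ (a + m)) k), ?_⟩
    rw [show geomExp (p ^ (a + m)) a = 1 + p ^ (a + m) * geomExp (p ^ (a + m)) k by
      rw [← geomExp_succ, ← hk], pow_add, pow_one, mul_pow δ, mul_assoc, ← pow_mul _ _ (p ^ a)]
    congr 3
    rw [pow_add]
    ring
  have hw₀ : ∃ w, γ₀ ^ geomExp (p ^ a) (a + m) = γ₀ * w ^ p ^ a := by
    obtain ⟨k, hk⟩ := Nat.exists_eq_add_of_le' (Nat.le_add_right_of_le ha : 1 ≤ a + m)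
    refine ⟨γ₀ ^ geomExp (p ^ a) k, ?_⟩
    rw [hk, geomExp_succ, pow_add, pow_one, mul_comm (p ^ a), pow_mul]
  obtain ⟨w, hw⟩ := hw
  obtain ⟨w₀, hw₀⟩ := hw₀
  refine ⟨_, h3, w₀ / w, ?_⟩
  rw [hw, hw₀, div_pow, ← mul_div_assoc γ₀, div_mul_div_comm, eq_div_iff_mul_eq']
  simp only [mul_comm, mul_left_comm, mul_assoc]

theorem exists_isOrbitUnion [Group.FG G] (hp : 2 ≤ p)
    (hI : ∀ (g : G) (k : ℕ), Topology.IsInducing fun y => g * y ^ p ^ k)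
    (hRfin : R.Finite) (hR : ∀ x : G, ∃ r ∈ R, ∃ y, x = r * y ^ p)
    {𝒮 : Set (Set G)} (hfin : 𝒮.Finite) (hcl : ∀ S ∈ 𝒮, IsClosed S)
    (hsec : ∀ S ∈ 𝒮, ∀ r ∈ R, {y | r * y ^ p ∈ S} ∈ 𝒮) {e : ℕ} (he : 1 ≤ e) :
    ∃ a, 1 ≤ a ∧ e ∣ a ∧ ∀ S ∈ 𝒮, IsOrbitUnion (p ^ a) S := by
  obtain ⟨a, ha, hea, hloop⟩ := exists_uniform_loop_length (p := p) (R := R) hfin he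
  refine ⟨a, ha, hea, ?_⟩
  have hreach : ∀ S, {T | T ∈ 𝒮 ∧ SectionReach p R S T}.Finite :=
    fun S => hfin.subset fun T hT => hT.1
  intro S hS
  induction hn : {T | T ∈ 𝒮 ∧ SectionReach p R S T}.ncard using Nat.strong_induction_on
    generalizing S with
  | _ n ih =>
  have hnon : ∀ γ ∈ powReps p R a, ¬ SectionReach p R (powSection p a γ S) S →
      IsOrbitUnion (p ^ a) (powSection p a γ S) := by
    intro γ hγ hret
    refine ih _ ?_ _ (powSection_mem hsec hγ hS) rfl
    rw [← hn]
    refine Set.ncard_lt_ncard ⟨fun T hT => ⟨hT.1, SectionReach.trans ⟨a, γ, hγ, rfl⟩ hT.2⟩,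
      fun hcon => hret (hcon ⟨hS, SectionReach.refl S⟩).2⟩ (hreach S)
  set N := {γ | γ ∈ powReps p R a ∧ ¬ SectionReach p R (powSection p a γ S) S}
  have hN : N.Finite := (powReps_finite hRfin a).subset fun γ h => h.1
  have hE : IsOrbitUnion (p ^ a)
      (⋃ γ ∈ N, (fun y => γ * y ^ p ^ a) '' powSection p a γ S) :=
    IsOrbitUnion.biUnion hN fun γ hγ => (hnon γ hγ.1 hγ.2).image γ _
  set E := ⋃ γ ∈ N, (fun y => γ * y ^ p ^ a) '' powSection p a γ S
  have hES : E ⊆ S := by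
    refine Set.iUnion₂_subset fun γ hγ => ?_
    rintro _ ⟨y, hy, rfl⟩
    exact hy
  have hcov : ∀ x ∈ S, x ∈ E ∨ ∃ γ ∈ powReps p R a,
      SectionReach p R (powSection p a γ S) S ∧ ∃ y, x = γ * y ^ p ^ a := by
    intro x hx
    obtain ⟨γ, hγ, y, rfl⟩ := exists_powReps hR a x
    by_cases hret : SectionReach p R (powSection p a γ S) S
    · exact Or.inr ⟨γ, hγ, hret, y, rfl⟩
    · exact Or.inl (Set.mem_iUnion₂.2 ⟨γ, ⟨hγ, hret⟩, y, hx, rfl⟩)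
  by_cases hex : ∃ γ ∈ powReps p R a, SectionReach p R (powSection p a γ S) S
  · obtain ⟨γ, hγ, m, δ, hδ, hret⟩ := hex
    obtain ⟨γ₀, -, h₀⟩ := hloop S hS ⟨a + m, by omega, _, mul_mem_powReps hγ hδ, by
      rw [← powSection_powSection, hret]⟩
    refine isOrbitUnion_of_step hp hI (hcl S hS) ha (fun y => Set.ext_iff.1 h₀ y) hE hES
      fun x hx => (hcov x hx).imp id ?_
    rintro ⟨γ, hγ, hret, y, rfl⟩
    obtain ⟨b, hb, z, rfl⟩ := exists_stabilizer_of_returning hI (hcl S hS) ha h₀ hret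
    refine ⟨z * y, ?_, b, hb, ?_⟩
    · rw [← h₀]
      change γ₀ * (z * y) ^ p ^ a ∈ S
      rw [← MulAction.mem_stabilizer_set.1 hb, smul_eq_mul]
      convert hx using 1
      rw [mul_pow]
      simp only [mul_comm, mul_left_comm]
    · rw [mul_pow]
      simp only [mul_comm, mul_left_comm]
  · convert hE using 1
    refine Set.Subset.antisymm (fun x hx => ?_) hES
    rcases hcov x hx with h | ⟨γ, hγ, hret, -⟩
    · exact h
    · exact absurd ⟨γ, hγ, hret⟩ hex

end Automaton

section Cartier

variable {K : Type*} [Field K]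

/-- The monomials of degree at most `D` in the elements of `Y`. -/
def boundedMonomials (Y : Finset K) (D : ℕ) : Set K :=
  {x | ∃ α : K → ℕ, ∑ y ∈ Y, α y ≤ D ∧ x = ∏ y ∈ Y, y ^ α y}

/-- The additive group generated by the monomials of degree at most `D` in the elements of `Y`. -/
def boundedSpan (Y : Finset K) (D : ℕ) : AddSubgroup K :=
  AddSubgroup.closure (boundedMonomials Y D)

theorem boundedMonomials_finite (Y : Finset K) (D : ℕ) : (boundedMonomials Y D).Finite := by
  refine (Set.finite_range fun α : Y → Fin (D + 1) => ∏ y : Y, (y : K) ^ (α y : ℕ)).subset ?_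
  rintro _ ⟨α, hα, rfl⟩
  refine ⟨fun y => ⟨α y, Nat.lt_succ_of_le ((Finset.single_le_sum (fun _ _ => Nat.zero_le _)
    y.2).trans hα)⟩, ?_⟩
  exact Finset.prod_coe_sort Y fun y => y ^ α y

theorem boundedSpan_finite {p : ℕ} [Fact p.Prime] [CharP K p] (Y : Finset K) (D : ℕ) :
    (boundedSpan Y D : Set K).Finite := by
  have : AddGroup.FG (boundedSpan Y D) := (AddGroup.fg_iff_addSubgroup_fg _).2
    ⟨(boundedMonomials_finite Y D).toFinset, by simp [boundedSpan]⟩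
  have : Finite (boundedSpan Y D) := AddCommGroup.finite_of_fg_isAddTorsion _ fun x =>
    isOfFinAddOrder_iff_nsmul_eq_zero.2 ⟨p, (Fact.out : p.Prime).pos, Subtype.ext (by simp)⟩
  exact Set.toFinite _

theorem boundedSpan_mono (Y : Finset K) {D D' : ℕ} (h : D ≤ D') :
    boundedSpan Y D ≤ boundedSpan Y D' := by
  refine AddSubgroup.closure_mono ?_
  rintro _ ⟨α, hα, rfl⟩
  exact ⟨α, hα.trans h, rfl⟩

theorem mul_mem_boundedSpan {Y : Finset K} {D D' : ℕ} {x y : K} (hx : x ∈ boundedSpan Y D)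
    (hy : y ∈ boundedSpan Y D') : x * y ∈ boundedSpan Y (D + D') := by
  induction hx using AddSubgroup.closure_induction with
  | zero => simp
  | add a b _ _ ha hb => rw [add_mul]; exact AddSubgroup.add_mem _ ha hb
  | neg a _ ha => rw [neg_mul]; exact AddSubgroup.neg_mem _ ha
  | mem x hx =>
    induction hy using AddSubgroup.closure_induction with
    | zero => simp
    | add a b _ _ ha hb => rw [mul_add]; exact AddSubgroup.add_mem _ ha hb
    | neg a _ ha => rw [mul_neg]; exact AddSubgroup.neg_mem _ ha
    | mem y hy =>
      obtain ⟨α, hα, rfl⟩ := hx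
      obtain ⟨β, hβ, rfl⟩ := hy
      refine AddSubgroup.subset_closure ⟨fun y => α y + β y, ?_, ?_⟩
      · rw [Finset.sum_add_distrib]
        omega
      · simp only [pow_add, Finset.prod_mul_distrib]

theorem one_mem_boundedSpan (Y : Finset K) (D : ℕ) : (1 : K) ∈ boundedSpan Y D :=
  AddSubgroup.subset_closure ⟨fun _ => 0, by simp, by simp⟩

theorem mem_boundedSpan_one {Y : Finset K} {y : K} (hy : y ∈ Y) : y ∈ boundedSpan Y 1 := by
  classical
  refine AddSubgroup.subset_closure ⟨fun z => if z = y then 1 else 0, by simp [hy], ?_⟩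
  simp [Finset.prod_ite_eq', hy, pow_ite]

theorem boundedSpan_le_closure (Y : Finset K) (D : ℕ) {x : K} (hx : x ∈ boundedSpan Y D) :
    x ∈ Subfield.closure (Y : Set K) := by
  induction hx using AddSubgroup.closure_induction with
  | zero => exact zero_mem _
  | add a b _ _ ha hb => exact add_mem ha hb
  | neg a _ ha => exact neg_mem ha
  | mem x hx =>
    obtain ⟨α, -, rfl⟩ := hx
    exact prod_mem fun y hy => pow_mem (Subfield.subset_closure hy) _

theorem exists_mem_boundedSpan {Y : Finset K} {x : K} (hx : x ∈ Subring.closure (Y : Set K)) :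
    ∃ D, x ∈ boundedSpan Y D := by
  induction hx using Subring.closure_induction with
  | zero => exact ⟨0, AddSubgroup.zero_mem _⟩
  | one => exact ⟨0, one_mem_boundedSpan _ _⟩
  | mem x hx => exact ⟨1, mem_boundedSpan_one hx⟩
  | neg x _ h => exact h.imp fun D hD => AddSubgroup.neg_mem _ hD
  | add x y _ _ hx hy =>
    obtain ⟨D, hD⟩ := hx
    obtain ⟨D', hD'⟩ := hy
    exact ⟨max D D', AddSubgroup.add_mem _ (boundedSpan_mono Y (le_max_left _ _) hD)
      (boundedSpan_mono Y (le_max_right _ _) hD')⟩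
  | mul x y _ _ hx hy =>
    obtain ⟨D, hD⟩ := hx
    obtain ⟨D', hD'⟩ := hy
    exact ⟨D + D', mul_mem_boundedSpan hD hD'⟩

theorem exists_sum_mul_pow {p : ℕ} [Fact p.Prime] [CharP K p] {Y : Finset K} {D k : ℕ}
    (hk : D / p ≤ k) {x : K} (hx : x ∈ boundedSpan Y D) :
    ∃ g : K → K, (∀ e, g e ∈ boundedSpan Y k) ∧
      x = ∑ e ∈ (boundedMonomials_finite Y (Y.card * (p - 1))).toFinset, e * g e ^ p := by
  classical
  have hp : p.Prime := Fact.out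
  induction hx using AddSubgroup.closure_induction with
  | zero => exact ⟨fun _ => 0, fun _ => AddSubgroup.zero_mem _, by simp [hp.ne_zero]⟩
  | add a b _ _ ha hb =>
    obtain ⟨g, hg, rfl⟩ := ha
    obtain ⟨g', hg', rfl⟩ := hb
    refine ⟨fun e => g e + g' e, fun e => AddSubgroup.add_mem _ (hg e) (hg' e), ?_⟩
    simp only [add_pow_char, mul_add, Finset.sum_add_distrib]
  | neg a _ ha =>
    obtain ⟨g, hg, rfl⟩ := ha
    refine ⟨fun e => -g e, fun e => AddSubgroup.neg_mem _ (hg e), ?_⟩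
    rw [← Finset.sum_neg_distrib]
    refine Finset.sum_congr rfl fun e _ => ?_
    rw [← frobenius_def p (-g e), map_neg, frobenius_def, mul_neg]
  | mem x hx =>
    obtain ⟨α, hα, rfl⟩ := hx
    set e₀ := ∏ y ∈ Y, y ^ (α y % p)
    have he₀ : e₀ ∈ boundedMonomials Y (Y.card * (p - 1)) := by
      refine ⟨fun y => α y % p, ?_, rfl⟩
      rw [← smul_eq_mul]
      exact Finset.sum_le_card_nsmul _ _ _ fun y _ => Nat.le_pred_of_lt (Nat.mod_lt _ hp.pos)
    refine ⟨fun e => if e = e₀ then ∏ y ∈ Y, y ^ (α y / p) else 0, fun e => ?_, ?_⟩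
    · beta_reduce
      split_ifs
      · refine AddSubgroup.subset_closure ⟨fun y => α y / p, le_trans ?_ hk, rfl⟩
        rw [Nat.le_div_iff_mul_le hp.pos, Finset.sum_mul]
        exact (Finset.sum_le_sum fun y _ => Nat.div_mul_le_self _ _).trans hα
      · exact AddSubgroup.zero_mem _
    · beta_reduce
      rw [Finset.sum_eq_single e₀ (fun e _ he => by simp [he, hp.ne_zero])
        (fun h => absurd ((Set.Finite.mem_toFinset _).2 he₀) h), if_pos rfl, ← Finset.prod_pow,
        ← Finset.prod_mul_distrib]
      refine Finset.prod_congr rfl fun y _ => ?_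
      rw [← pow_mul, ← pow_add, Nat.mod_add_div']

theorem exists_finite_frobenius_decomposition {p : ℕ} [Fact p.Prime] [CharP K p] (Y : Finset K) :
    ∃ V : Set K, V.Finite ∧ (Y : Set K) ⊆ V ∧ (0 : K) ∈ V ∧
      V ⊆ (Subfield.closure (Y : Set K) : Set K) ∧
      ∃ (I : Finset K) (c : K → K),
        (∀ h : K → K, (∀ i ∈ I, h i ∈ Subfield.closure (Y : Set K)) →
          ∑ i ∈ I, c i * h i ^ p = 0 → ∀ i ∈ I, h i = 0) ∧
        ∀ v ∈ V, ∀ m ∈ Y, ∃ g : K → K, (∀ i, g i ∈ V) ∧ m * v = ∑ i ∈ I, c i * g i ^ p := by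
  classical
  have hp : p.Prime := Fact.out
  set L := Subfield.closure (Y : Set K)
  set F := L.map (frobenius K p)
  set E := (boundedMonomials_finite Y (Y.card * (p - 1))).toFinset
  obtain ⟨b, hbE, hspan, hli⟩ := exists_linearIndependent F (E : Set K)
  have hbfin : b.Finite := E.finite_toSet.subset hbE
  set I := hbfin.toFinset
  have hcoef : ∀ e : K, ∃ lam : K → K, (∀ i, lam i ∈ L) ∧ (e ∈ E → e = ∑ i ∈ I, i * lam i ^ p) := by
    intro e
    by_cases he : e ∈ E
    · have : e ∈ Submodule.span F ((I : Finset K) : Set K) := by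
        rw [hbfin.coe_toFinset, hspan]
        exact Submodule.subset_span he
      obtain ⟨f, -, hf⟩ := Submodule.mem_span_finset.1 this
      choose lam hlam using fun i => Subfield.mem_map.1 (f i).2
      refine ⟨lam, fun i => (hlam i).1, fun _ => ?_⟩
      rw [← hf]
      refine Finset.sum_congr rfl fun i _ => ?_
      rw [← frobenius_def, (hlam i).2, Subfield.smul_def, smul_eq_mul, mul_comm]
    · exact ⟨0, fun _ => zero_mem _, fun h => absurd h he⟩
  choose lam hlam hlam' using hcoef
  have hden : ∃ δ : K, δ ≠ 0 ∧ ∃ D₁, ∀ e ∈ E, ∀ i ∈ I, δ * lam e i ∈ boundedSpan Y D₁ := by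
    have hfrac : ∀ e i, ∃ y ∈ Subring.closure (Y : Set K), ∃ z ∈ Subring.closure (Y : Set K),
        z ≠ 0 ∧ z * lam e i = y := by
      intro e i
      obtain ⟨y, hy, z, hz, hyz⟩ := Subfield.mem_closure_iff.1 (hlam e i)
      rcases eq_or_ne z 0 with rfl | hz0
      · exact ⟨0, zero_mem _, 1, one_mem _, one_ne_zero, by rw [← hyz]; simp⟩
      · exact ⟨y, hy, z, hz, hz0, by rw [← hyz, mul_div_cancel₀ _ hz0]⟩
    choose y hy z hz hz0 hyz using hfrac
    set δ := ∏ x ∈ E ×ˢ I, z x.1 x.2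
    have hmem : ∀ e i, ∃ D, e ∈ E → i ∈ I → δ * lam e i ∈ boundedSpan Y D := by
      intro e i
      by_cases h : e ∈ E ∧ i ∈ I
      · have hei : (e, i) ∈ E ×ˢ I := Finset.mk_mem_product h.1 h.2
        obtain ⟨D, hD⟩ := exists_mem_boundedSpan (Y := Y) (x := δ * lam e i) (by
          rw [show δ = _ from (Finset.mul_prod_erase _ (fun x => z x.1 x.2) hei).symm,
            mul_right_comm, hyz]
          exact mul_mem (hy e i) (prod_mem fun x _ => hz _ _))
        exact ⟨D, fun _ _ => hD⟩
      · exact ⟨0, fun h₁ h₂ => absurd ⟨h₁, h₂⟩ h⟩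
    choose D hD using hmem
    refine ⟨δ, Finset.prod_ne_zero_iff.2 fun x _ => hz0 _ _, (E ×ˢ I).sup fun x => D x.1 x.2,
      fun e he i hi => boundedSpan_mono Y ?_ (hD e i he hi)⟩
    exact Finset.le_sup (f := fun x : K × K => D x.1 x.2) (Finset.mk_mem_product he hi)
  obtain ⟨δ, hδ, D₁, hD₁⟩ := hden
  refine ⟨boundedSpan Y (2 * D₁ + 1), boundedSpan_finite (p := p) Y _, fun y hy =>
    boundedSpan_mono Y (by omega) (mem_boundedSpan_one hy), AddSubgroup.zero_mem _,
    fun x hx => boundedSpan_le_closure Y _ hx, I, fun i => i / δ ^ p, ?_, ?_⟩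
  · intro h hh hsum i hi
    have hli' : LinearIndepOn F id (I : Set K) := by
      rw [hbfin.coe_toFinset]
      exact hli
    have hF : ∀ j, j ∈ I → h j ^ p ∈ F := fun j hj => Subfield.mem_map.2 ⟨h j, hh j hj, rfl⟩
    have := linearIndepOn_finset_iff.1 hli' (fun j => if hj : j ∈ I then ⟨h j ^ p, hF j hj⟩ else 0)
      (by
        have hmul := congrArg (δ ^ p * ·) hsum
        simp only [mul_zero, Finset.mul_sum] at hmul
        rw [← hmul]
        refine Finset.sum_congr rfl fun j hj => ?_
        rw [dif_pos hj, Subfield.smul_def, smul_eq_mul, id]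
        field_simp) i hi
    rw [dif_pos hi] at this
    exact eq_zero_of_pow_eq_zero (congrArg Subtype.val this)
  · intro v hv m hm
    have hmv := mul_mem_boundedSpan (mem_boundedSpan_one hm) hv
    obtain ⟨g, hg, hmv⟩ := exists_sum_mul_pow (p := p) (k := D₁ + 1)
      (Nat.div_le_of_le_mul (by nlinarith [hp.two_le])) hmv
    refine ⟨fun i => if i ∈ I then ∑ e ∈ E, δ * lam e i * g e else 0, fun i => ?_, ?_⟩
    · beta_reduce
      split_ifs with hi
      · refine AddSubgroup.sum_mem _ fun e he => ?_
        exact boundedSpan_mono Y (by omega) (mul_mem_boundedSpan (hD₁ e he i hi) (hg e))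
      · exact AddSubgroup.zero_mem _
    · rw [hmv]
      calc _ = ∑ e ∈ E, ∑ i ∈ I, i * lam e i ^ p * g e ^ p := by
            refine Finset.sum_congr rfl fun e he => ?_
            rw [← Finset.sum_mul, ← hlam' e he]
        _ = ∑ i ∈ I, ∑ e ∈ E, i * lam e i ^ p * g e ^ p := Finset.sum_comm
        _ = _ := by
            refine Finset.sum_congr rfl fun i hi => ?_
            beta_reduce
            rw [if_pos hi, sum_pow_char, Finset.mul_sum]
            refine Finset.sum_congr rfl fun e _ => ?_
            rw [mul_pow, mul_pow]
            field_simp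

/-- The common zeros in `G` of the combinations `∑ m ∈ M, a m • χ m` with `a ∈ A`. -/
def charZeros {G ι : Type*} [Monoid G] (M : Finset ι) (χ : ι → G →* K) (A : Set (ι → K)) : Set G :=
  {x | ∀ a ∈ A, ∑ m ∈ M, a m * χ m x = 0}

theorem map_mem_subfieldClosure {G : Type*} [Group G] {T : Set G} (hT : Subgroup.closure T = ⊤)
    {Y : Set K} (χ : G →* K) (hχ : ∀ t ∈ T, χ t ∈ Y) (x : G) : χ x ∈ Subfield.closure Y := by
  have hx : x ∈ Subgroup.closure T := hT ▸ Subgroup.mem_top x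
  induction hx using Subgroup.closure_induction with
  | mem x hx => exact Subfield.subset_closure (hχ x hx)
  | one => rw [map_one]; exact one_mem _
  | mul x y _ _ hx hy => rw [map_mul]; exact mul_mem hx hy
  | inv x _ hx =>
    have : χ x⁻¹ = (χ x)⁻¹ := eq_inv_of_mul_eq_one_left (by rw [← map_mul, inv_mul_cancel, map_one])
    rw [this]
    exact inv_mem hx

theorem exists_finite_sections {p : ℕ} [Fact p.Prime] [CharP K p] {G ι : Type*} [CommGroup G]
    [Group.FG G] (M : Finset ι) (χ : ι → G →* K) {A₀ : Set (ι → K)} (hA₀ : A₀.Finite)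
    {R : Set G} (hR : R.Finite) :
    ∃ 𝒮 : Set (Set G), 𝒮.Finite ∧ charZeros M χ A₀ ∈ 𝒮 ∧
      (∀ S ∈ 𝒮, ∃ A, S = charZeros M χ A) ∧ ∀ S ∈ 𝒮, ∀ r ∈ R, {y | r * y ^ p ∈ S} ∈ 𝒮 := by
  classical
  have hp : p.Prime := Fact.out
  obtain ⟨T, hT⟩ := Group.fg_def.1 (inferInstance : Group.FG G)
  have hYfin : (Set.image2 (fun a m => a m) A₀ M ∪ Set.image2 (fun m r => χ m r) M R ∪
      Set.image2 (fun m t => χ m t) M T : Set K).Finite :=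
    ((hA₀.image2 _ M.finite_toSet).union (M.finite_toSet.image2 _ hR)).union
      (M.finite_toSet.image2 _ T.finite_toSet)
  set Y := hYfin.toFinset
  have hYA : ∀ a ∈ A₀, ∀ m ∈ M, a m ∈ Y := fun a ha m hm =>
    hYfin.mem_toFinset.2 (Or.inl (Or.inl ⟨a, ha, m, hm, rfl⟩))
  have hYR : ∀ m ∈ M, ∀ r ∈ R, χ m r ∈ Y := fun m hm r hr =>
    hYfin.mem_toFinset.2 (Or.inl (Or.inr ⟨m, hm, r, hr, rfl⟩))
  have hYT : ∀ m ∈ M, ∀ t ∈ (T : Set G), χ m t ∈ (Y : Set K) := fun m hm t ht =>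
    hYfin.mem_toFinset.2 (Or.inr ⟨m, hm, t, ht, rfl⟩)
  obtain ⟨V, hVfin, hYV, -, hVL, I, c, hindep, hdec⟩ :=
    exists_finite_frobenius_decomposition (p := p) Y
  choose g hgV hg using hdec
  have : Finite V := hVfin
  let ext : (M → V) → ι → K := fun a m => if hm : m ∈ M then (a ⟨m, hm⟩ : K) else 0
  have hext : ∀ (b : ι → K) (hb : ∀ m ∈ M, b m ∈ V), ∀ m ∈ M,
      ext (fun m => ⟨b m, hb m m.2⟩) m = b m := fun b hb m hm => dif_pos hm
  have hextV : ∀ a, ∀ m ∈ M, ext a m ∈ V := fun a m hm => by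
    simp only [ext, dif_pos hm]
    exact Subtype.coe_prop _
  refine ⟨Set.range fun A : Set (M → V) => charZeros M χ (ext '' A), Set.finite_range _, ?_, ?_, ?_⟩
  · refine ⟨{a | ∃ a₀ ∈ A₀, ∀ m ∈ M, ext a m = a₀ m}, ?_⟩
    ext x
    constructor
    · intro hx a₀ ha₀
      have hV : ∀ m ∈ M, a₀ m ∈ V := fun m hm => hYV (hYA a₀ ha₀ m hm)
      rw [← hx _ ⟨fun m => ⟨a₀ m, hV m m.2⟩, ⟨a₀, ha₀, hext a₀ hV⟩, rfl⟩]
      exact Finset.sum_congr rfl fun m hm => by rw [hext a₀ hV m hm]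
    · rintro hx _ ⟨a, ⟨a₀, ha₀, h⟩, rfl⟩
      rw [← hx a₀ ha₀]
      exact Finset.sum_congr rfl fun m hm => by rw [h m hm]
  · rintro _ ⟨A, rfl⟩
    exact ⟨_, rfl⟩
  · rintro _ ⟨A, rfl⟩ r hr
    let sec : (ι → K) → K → ι → K := fun a i m =>
      if h : a m ∈ V ∧ χ m r ∈ Y then g (a m) h.1 (χ m r) h.2 i else 0
    have hsecV : ∀ a i, ∀ m ∈ M, sec (ext a) i m ∈ V := fun a i m hm => by
      simp only [sec, dif_pos (And.intro (hextV a m hm) (hYR m hm r hr))]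
      exact hgV _ _ _ _ _
    have key : ∀ (a : M → V) (y : G), ∑ m ∈ M, ext a m * χ m (r * y ^ p) =
        ∑ i ∈ I, c i * (∑ m ∈ M, sec (ext a) i m * χ m y) ^ p := by
      intro a y
      calc _ = ∑ m ∈ M, ∑ i ∈ I, c i * (sec (ext a) i m * χ m y) ^ p := by
            refine Finset.sum_congr rfl fun m hm => ?_
            rw [map_mul, map_pow, ← mul_assoc, mul_comm (ext a m),
              hg _ (hextV a m hm) _ (hYR m hm r hr), Finset.sum_mul]
            refine Finset.sum_congr rfl fun i _ => ?_
            simp only [sec, dif_pos (And.intro (hextV a m hm) (hYR m hm r hr))]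
            rw [mul_pow, mul_assoc]
        _ = ∑ i ∈ I, ∑ m ∈ M, c i * (sec (ext a) i m * χ m y) ^ p := Finset.sum_comm
        _ = _ := by
            refine Finset.sum_congr rfl fun i _ => ?_
            rw [sum_pow_char, Finset.mul_sum]
    refine ⟨{b | ∃ a ∈ A, ∃ i ∈ I, ∀ m ∈ M, ext b m = sec (ext a) i m}, ?_⟩
    ext y
    constructor
    · rintro hy _ ⟨a, ha, rfl⟩
      rw [key]
      refine Finset.sum_eq_zero fun i hi => ?_
      have := hy _ ⟨fun m => ⟨sec (ext a) i m, hsecV a i m m.2⟩,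
        ⟨a, ha, i, hi, hext _ (hsecV a i)⟩, rfl⟩
      rw [Finset.sum_congr rfl fun m hm => by rw [hext _ (hsecV a i) m hm]] at this
      rw [this, zero_pow hp.ne_zero, mul_zero]
    · rintro hy _ ⟨b, ⟨a, ha, i, hi, hb⟩, rfl⟩
      have h0 := hy _ ⟨a, ha, rfl⟩
      rw [key] at h0
      rw [Finset.sum_congr rfl fun m hm => by rw [hb m hm]]
      refine hindep (fun i => ∑ m ∈ M, sec (ext a) i m * χ m y) (fun i _ => ?_) h0 i hi
      exact sum_mem fun m hm => mul_mem (hVL (hsecV a i m hm))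
        (map_mem_subfieldClosure hT (χ m) (hYT m hm) y)

end Cartier

section Torus

variable {K : Type*} [Field K] {N : ℕ}

/-- The Zariski topology on a subgroup of a torus. -/
@[reducible]
noncomputable def zariskiTopology (Γ : Subgroup (Fin N → Kˣ)) : TopologicalSpace Γ :=
  TopologicalSpace.induced (fun γ => MvPolynomial.pointToPoint (k := K) fun i => (γ.1 i : K))
    inferInstance

theorem isClosed_zariskiTopology_iff {Γ : Subgroup (Fin N → Kˣ)} {C : Set Γ} :
    @IsClosed Γ (zariskiTopology Γ) C ↔ ∃ s : Set (MvPolynomial (Fin N) K),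
      C = {γ | ∀ f ∈ s, MvPolynomial.eval (fun i => (γ.1 i : K)) f = 0} := by
  have key : ∀ s : Set (MvPolynomial (Fin N) K),
      (fun γ : Γ => MvPolynomial.pointToPoint (k := K) fun i => (γ.1 i : K)) ⁻¹'
        PrimeSpectrum.zeroLocus s = {γ | ∀ f ∈ s, MvPolynomial.eval (fun i => (γ.1 i : K)) f = 0} :=
    fun s => by
      ext γ
      rw [Set.mem_preimage, PrimeSpectrum.mem_zeroLocus]
      refine forall₂_congr fun f _ => ?_
      rw [SetLike.mem_coe]
      exact MvPolynomial.mem_vanishingIdeal_singleton_iff _ _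
  rw [zariskiTopology, isClosed_induced_iff]
  constructor
  · rintro ⟨t, ht, rfl⟩
    obtain ⟨s, rfl⟩ := (PrimeSpectrum.isClosed_iff_zeroLocus t).1 ht
    exact ⟨s, key s⟩
  · rintro ⟨s, rfl⟩
    exact ⟨_, PrimeSpectrum.isClosed_zeroLocus s, key s⟩

theorem noetherianSpace_zariskiTopology (Γ : Subgroup (Fin N → Kˣ)) :
    @TopologicalSpace.NoetherianSpace Γ (zariskiTopology Γ) :=
  let := zariskiTopology Γ
  Topology.IsInducing.noetherianSpace
    (i := fun γ : Γ => MvPolynomial.pointToPoint (k := K) fun i => (γ.1 i : K)) ⟨rfl⟩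

theorem isInducing_mul_pow {p : ℕ} [Fact p.Prime] [CharP K p] (Γ : Subgroup (Fin N → Kˣ)) (g : Γ)
    (k : ℕ) :
    @Topology.IsInducing Γ Γ (zariskiTopology Γ) (zariskiTopology Γ) fun y => g * y ^ p ^ k := by
  let := zariskiTopology Γ
  have hp : p.Prime := Fact.out
  refine ⟨TopologicalSpace.ext_iff_isClosed.2 fun C => Iff.trans ?_
    (@isClosed_induced_iff Γ Γ (zariskiTopology Γ) C fun y => g * y ^ p ^ k).symm⟩
  constructor
  · intro hC
    obtain ⟨s, rfl⟩ := (isClosed_zariskiTopology_iff (Γ := Γ)).1 hC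
    refine ⟨_, isClosed_zariskiTopology_iff.2 ⟨(fun f => MvPolynomial.bind₁
      (fun i => MvPolynomial.C (((g.1 i)⁻¹ : Kˣ) : K) * MvPolynomial.X i)
      (MvPolynomial.map (iterateFrobenius K p k) f)) '' s, rfl⟩, ?_⟩
    ext y
    simp only [Set.mem_preimage, Set.mem_ofPred_eq, Set.forall_mem_image]
    refine forall₂_congr fun f hfs => ?_
    clear hfs
    have : MvPolynomial.eval (fun i => ((g * y ^ p ^ k).1 i : K)) (MvPolynomial.bind₁
        (fun i => MvPolynomial.C (((g.1 i)⁻¹ : Kˣ) : K) * MvPolynomial.X i)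
        (MvPolynomial.map (iterateFrobenius K p k) f)) =
        iterateFrobenius K p k (MvPolynomial.eval (fun i => (y.1 i : K)) f) := by
      induction f using MvPolynomial.induction_on with
      | C a => simp
      | add f f' hf hf' => simp only [map_add, hf, hf']
      | mul_X f i hf =>
        simp only [map_mul, hf]
        simp [iterateFrobenius_def]
    rw [this, iterateFrobenius_def, pow_eq_zero_iff (pow_ne_zero _ hp.ne_zero)]
  · rintro ⟨t, ht, rfl⟩
    obtain ⟨s, rfl⟩ := (isClosed_zariskiTopology_iff (Γ := Γ)).1 ht
    refine isClosed_zariskiTopology_iff.2 ⟨(fun f => MvPolynomial.bind₁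
      (fun i => MvPolynomial.C (g.1 i : K) * MvPolynomial.X i ^ p ^ k) f) '' s, ?_⟩
    ext y
    simp only [Set.mem_preimage, Set.mem_ofPred_eq, Set.forall_mem_image]
    refine forall₂_congr fun f hfs => Eq.congr_left ?_
    clear hfs
    induction f using MvPolynomial.induction_on with
    | C a => simp
    | add f f' hf hf' => simp only [map_add, hf, hf']
    | mul_X f i hf =>
      simp only [map_mul, hf]
      simp

/-- The restriction to `Γ` of the character of the torus with exponent vector `m`. -/
def monomialChar (Γ : Subgroup (Fin N → Kˣ)) (m : Fin N →₀ ℕ) : Γ →* K where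
  toFun γ := ∏ i, (γ.1 i : K) ^ m i
  map_one' := by simp
  map_mul' x y := by simp [mul_pow, Finset.prod_mul_distrib]

theorem isClosed_charZeros (Γ : Subgroup (Fin N → Kˣ)) (M : Finset (Fin N →₀ ℕ))
    (A : Set ((Fin N →₀ ℕ) → K)) :
    @IsClosed Γ (zariskiTopology Γ) (charZeros M (monomialChar Γ) A) := by
  refine isClosed_zariskiTopology_iff.2
    ⟨(fun a => ∑ m ∈ M, MvPolynomial.monomial m (a m)) '' A, ?_⟩
  ext γ
  simp only [charZeros, Set.mem_ofPred_eq, Set.forall_mem_image]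
  refine forall₂_congr fun a _ => ?_
  rw [map_sum]
  simp [monomialChar, MvPolynomial.eval_monomial, Finsupp.prod_fintype]

theorem exists_charZeros_eq (Γ : Subgroup (Fin N → Kˣ)) (polys : Set (MvPolynomial (Fin N) K)) :
    ∃ (M : Finset (Fin N →₀ ℕ)) (A : Set ((Fin N →₀ ℕ) → K)), A.Finite ∧
      {γ : Γ | ∀ f ∈ polys, MvPolynomial.eval (fun i => (γ.1 i : K)) f = 0} =
        charZeros M (monomialChar Γ) A := by
  classical
  obtain ⟨s, hs, hspan⟩ := Submodule.fg_span_iff_fg_span_finset_subset polys |>.1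
    (IsNoetherian.noetherian (Ideal.span polys))
  refine ⟨s.biUnion MvPolynomial.support, (fun f m => MvPolynomial.coeff m f) '' (s : Set _),
    s.finite_toSet.image _, ?_⟩
  ext γ
  simp only [charZeros, Set.mem_ofPred_eq, Set.forall_mem_image]
  have heval : ∀ f ∈ s, ∑ m ∈ s.biUnion MvPolynomial.support, MvPolynomial.coeff m f *
      monomialChar Γ m γ = MvPolynomial.eval (fun i => (γ.1 i : K)) f := by
    intro f hf
    rw [MvPolynomial.eval_eq']
    refine (Finset.sum_subset (Finset.subset_biUnion_of_mem _ hf) fun m _ hm => ?_).symm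
    rw [MvPolynomial.notMem_support_iff.1 hm, zero_mul]
  constructor
  · intro h f hf
    rw [heval f hf]
    exact h f (hs hf)
  · intro h
    have hle : Ideal.span (s : Set (MvPolynomial (Fin N) K)) ≤
        RingHom.ker (MvPolynomial.eval fun i => (γ.1 i : K)) :=
      Ideal.span_le.2 fun f hf => (heval f hf).symm.trans (h hf)
    intro f hf
    refine hle ?_
    rw [Ideal.span, ← hspan]
    exact Submodule.subset_span hf

end Torus

theorem exists_finite_pow_reps {G : Type*} [CommGroup G] [Group.FG G] {p : ℕ} (hp : p ≠ 0) :
    ∃ R : Set G, R.Finite ∧ ∀ x, ∃ r ∈ R, ∃ y, x = r * y ^ p := by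
  have := Subgroup.finiteIndex_iff_finite_quotient.1
    (Subgroup.finiteIndex_range_powMonoidHom_of_fg G hp)
  refine ⟨Set.range (Quotient.out : G ⧸ (powMonoidHom (α := G) p).range → G), Set.finite_range _,
    fun x => ⟨_, ⟨QuotientGroup.mk x, rfl⟩, ?_⟩⟩
  obtain ⟨⟨_, y, rfl⟩, hy⟩ := QuotientGroup.mk_out_eq_mul (powMonoidHom (α := G) p).range x
  refine ⟨y⁻¹, ?_⟩
  rw [hy]
  simp

section Conversion

theorem sArithSeq_one {S : Set ℂ} (hS : (1 : ℂ) ∈ S) : SArithSeq S fun _ => 1 :=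
  ⟨1, fun _ => 1, fun _ => 1, Function.injective_of_subsingleton _, fun _ => hS, by simp⟩

theorem sArithSeq_geomExp {S : Set ℂ} {Q : ℕ} (hQ : 2 ≤ Q) (h1 : (1 : ℂ) ∈ S) (hQS : (Q : ℂ) ∈ S) :
    SArithSeq S fun n => geomExp Q (n - 1) := by
  have hQ0 : (Q : ℂ) ≠ 0 := by exact_mod_cast (by omega : Q ≠ 0)
  have hQ1 : (Q : ℂ) ≠ 1 := by exact_mod_cast (by omega : Q ≠ 1)
  have hQ1' : (Q : ℂ) - 1 ≠ 0 := sub_ne_zero.2 hQ1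
  refine ⟨2, ![1, Q], ![-1 / (Q - 1), 1 / (Q * (Q - 1))], ?_, ?_, ?_⟩
  · intro i j
    fin_cases i <;> fin_cases j <;> simp [hQ1, hQ1.symm]
  · intro i
    fin_cases i <;> simpa
  · intro n hn
    obtain ⟨n, rfl⟩ := Nat.exists_eq_add_of_le' hn
    have : (geomExp Q n : ℂ) = ((Q : ℂ) ^ n - 1) / (Q - 1) := by
      rw [geomExp]
      push_cast
      exact geom_sum_eq hQ1 n
    simp only [Nat.add_sub_cancel, Int.cast_natCast, this, Fin.sum_univ_two, Matrix.cons_val_zero,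
      Matrix.cons_val_one]
    field_simp
    ring

theorem mem_orbitSet_iff {G : Type*} [CommGroup G] {Q : ℕ} {l : List G} {x : G} :
    x ∈ orbitSet Q 0 l ↔ ∃ n : Fin l.length → ℕ, x = ∏ i, l.get i ^ geomExp Q (n i) := by
  induction l generalizing x with
  | nil => simp [orbitSet]
  | cons c l ih =>
    simp only [orbitSet, Set.mem_ofPred_eq, ih]
    constructor
    · rintro ⟨n, -, y, ⟨v, rfl⟩, rfl⟩
      exact ⟨Fin.cons n v, by simp [Fin.prod_univ_succ]⟩
    · rintro ⟨v, rfl⟩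
      exact ⟨v 0, Nat.zero_le _, _, ⟨fun i => v i.succ, rfl⟩, by simp [Fin.prod_univ_succ]⟩

theorem mulSArithGroupless_orbitSet {G : Type*} [CommGroup G] {S : Set ℂ} {Q : ℕ} (hQ : 2 ≤ Q)
    (h1 : (1 : ℂ) ∈ S) (hQS : (Q : ℂ) ∈ S) (c : G) (l : List G) :
    MulSArithGroupless S {x | ∃ y ∈ orbitSet Q 0 l, x = c * y} := by
  refine ⟨l.length + 1, by omega, Fin.cons c l.get,
    Fin.cons (fun _ => 1) fun _ n => geomExp Q (n - 1), ?_, ?_⟩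
  · refine Fin.cases ?_ fun i => ?_
    · exact sArithSeq_one h1
    · exact sArithSeq_geomExp hQ h1 hQS
  · ext x
    simp only [Set.mem_ofPred_eq, mem_orbitSet_iff]
    constructor
    · rintro ⟨_, ⟨n, rfl⟩, rfl⟩
      refine ⟨Fin.cons 1 fun i => n i + 1, Fin.cases (by simp) (by simp), ?_⟩
      simp [Fin.prod_univ_succ]
    · rintro ⟨n, -, rfl⟩
      exact ⟨_, ⟨fun i => n i.succ - 1, rfl⟩, by simp [Fin.prod_univ_succ]⟩

theorem orbitSet_map {G H : Type*} [CommGroup G] [CommGroup H] (φ : G →* H) (Q M : ℕ) (l : List G) :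
    φ '' orbitSet Q M l = orbitSet Q M (l.map φ) := by
  induction l with
  | nil => simp [orbitSet]
  | cons c l ih =>
    simp only [List.map_cons, orbitSet, ← ih]
    ext x
    constructor
    · rintro ⟨_, ⟨n, hn, y, hy, rfl⟩, rfl⟩
      exact ⟨n, hn, φ y, ⟨y, hy, rfl⟩, by simp⟩
    · rintro ⟨n, hn, _, ⟨y, hy, rfl⟩, rfl⟩
      exact ⟨_, ⟨n, hn, y, hy, rfl⟩, by simp⟩

theorem mulSArithSetIn_image_orbitPiece {G : Type*} [CommGroup G] {Γ : Subgroup G} {S : Set ℂ}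
    {Q : ℕ} (hQ : 2 ≤ Q) (h1 : (1 : ℂ) ∈ S) (hQS : (Q : ℂ) ∈ S) (c : Γ) (l : List Γ)
    (H : Subgroup Γ) : MulSArithSetIn S Γ (Subtype.val '' orbitPiece Q c l H) := by
  refine ⟨{x | ∃ y ∈ orbitSet Q 0 (l.map Γ.subtype), x = c * y}, H.map Γ.subtype,
    mulSArithGroupless_orbitSet hQ h1 hQS (c : G) (l.map Γ.subtype), ?_,
    Subgroup.map_subtype_le H, ?_⟩
  · rintro _ ⟨y, hy, rfl⟩
    rw [← orbitSet_map] at hy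
    obtain ⟨y, -, rfl⟩ := hy
    exact mul_mem c.2 y.2
  · ext x
    rw [← orbitSet_map, Set.mem_mul]
    constructor
    · rintro ⟨_, ⟨y, hy, h, hh, rfl⟩, rfl⟩
      exact ⟨_, ⟨_, ⟨y, hy, rfl⟩, rfl⟩, _, ⟨h, hh, rfl⟩, rfl⟩
    · rintro ⟨_, ⟨_, ⟨y, hy, rfl⟩, rfl⟩, _, ⟨h, hh, rfl⟩, rfl⟩
      exact ⟨_, ⟨y, hy, h, hh, rfl⟩, rfl⟩

end Conversion

/-- **Theorem (main theorem for algebraic tori).** Let `K` be an algebraically closed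
field of characteristic `p > 0`, `q = p^e` a power of `p`, `N ≥ 1`, `X ⊆ K^N` the zero
locus of a set of polynomials, and `Γ` a finitely generated subgroup of `(K^×)^N`.
With `S_q = {q^s : s ≥ 0}`, the set `{γ ∈ Γ : γ ∈ X}` is a finite union of
multiplicative `S_q`-arithmetic sets in `Γ` (based in `(K^×)^N`). -/
theorem mordell_lang_torus {K : Type*} [Field K] [IsAlgClosed K]
    (p : ℕ) [Fact (Nat.Prime p)] [CharP K p]
    (q : ℕ) (hq : ∃ e : ℕ, 1 ≤ e ∧ q = p ^ e)
    (N : ℕ) (hN : 1 ≤ N)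
    (polys : Set (MvPolynomial (Fin N) K))
    (Γ : Subgroup (Fin N → Kˣ)) (hΓ : Γ.FG) :
    ∃ (k : ℕ) (Fs : Fin k → Set (Fin N → Kˣ)),
      (∀ i, MulSArithSetIn {z : ℂ | ∃ s : ℕ, z = (q : ℂ) ^ s} Γ (Fs i)) ∧
      {γ : Fin N → Kˣ | γ ∈ Γ ∧ ∀ f ∈ polys, MvPolynomial.eval (fun i => (γ i : K)) f = 0}
        = ⋃ i, Fs i := by
  classical
  have hp : p.Prime := Fact.out
  obtain ⟨e, he, rfl⟩ := hq
  have : Group.FG Γ := (Group.fg_iff_subgroup_fg Γ).2 hΓ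
  let := zariskiTopology Γ
  have := noetherianSpace_zariskiTopology Γ
  obtain ⟨R, hRfin, hR⟩ := exists_finite_pow_reps (G := Γ) hp.ne_zero
  obtain ⟨M, A, hA, hMA⟩ := exists_charZeros_eq Γ polys
  obtain ⟨𝒮, hfin, hmem, hchar, hsec⟩ :=
    exists_finite_sections (p := p) M (monomialChar Γ) hA hRfin
  obtain ⟨a, ha, ⟨s, rfl⟩, hunion⟩ := exists_isOrbitUnion hp.two_le (isInducing_mul_pow Γ) hRfin hR
    hfin (fun S hS => by
      obtain ⟨A, rfl⟩ := hchar S hS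
      exact isClosed_charZeros Γ M A) hsec he
  obtain ⟨𝓟, hfin𝓟, h𝓟, hS⟩ := hunion _ hmem
  obtain ⟨k, ⟨f⟩⟩ := hfin𝓟.exists_equiv_fin
  have hQ : 2 ≤ p ^ (e * s) := hp.two_le.trans (Nat.le_self_pow (by omega) p)
  refine ⟨k, fun i => Subtype.val '' (f.symm i : Set Γ), fun i => ?_, ?_⟩
  · obtain ⟨c, l, H, hP⟩ := h𝓟 _ (f.symm i).2
    beta_reduce
    rw [hP]
    exact mulSArithSetIn_image_orbitPiece hQ (Exists.intro 0 (by simp))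
      (Exists.intro s (by push_cast; rw [pow_mul])) c l H
  · rw [← Set.image_iUnion, f.symm.surjective.iUnion_comp (fun P : 𝓟 => (P : Set Γ)),
      ← Set.sUnion_eq_iUnion, ← hS, ← hMA]
    ext γ
    simp [and_comm]
end

section
/- Let K be an algebraically closed field of characteristic p > 0, let q be a power of p, and let N ≥ 1. Let X ⊆ K^N be the zero locus of a set of polynomials in N variables with coefficients in K, and let Γ be a finitely generated subgroup of the multiplicative group (K^×)^N. Assume there exists a positive integer ℓ such that Γ is mapped into itself by the map F^ℓ, where F : (K^×)^N → (K^×)^N is the q-power map γ ↦ γ^q (componentwise q-th power). Then the set {γ ∈ Γ : γ ∈ X} is a finite union of multiplicative F-sets in Γ (based in (K^×)^N). -/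
open Pointwise

/-- A multiplicative groupless `F`-set based in the (multiplicatively written) abelian
group `G`, where `F` is the `q`-power map: a set of the form
`{α₀ · ∏ i, α i ^ (q ^ (k i * n i)) : n_1, …, n_r ∈ ℕ}` with each `k i ≥ 1`. -/
def MulGrouplessFSet (q : ℕ) {G : Type*} [CommGroup G] (U : Set G) : Prop :=
  ∃ (r : ℕ) (α₀ : G) (α : Fin r → G) (k : Fin r → ℕ),
    (∀ i, 1 ≤ k i) ∧
    U = {x | ∃ n : Fin r → ℕ, x = α₀ * ∏ i, α i ^ (q ^ (k i * n i))}

/-- A multiplicative `F`-set in the subgroup `Γ` (based in `G`): a set of the form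
`U · B` where `U` is a multiplicative groupless `F`-set contained in `Γ` and `B` is a
subgroup of `Γ`. -/
def MulFSetIn (q : ℕ) {G : Type*} [CommGroup G] (Γ : Subgroup G) (F : Set G) : Prop :=
  ∃ (U : Set G) (B : Subgroup G),
    MulGrouplessFSet q U ∧ U ⊆ (Γ : Set G) ∧ B ≤ Γ ∧ F = U * (B : Set G)

namespace MoosaScanlon

open Finset

section FSets

variable {A : Type*} [AddCommGroup A]

/-- The geometric sum `1 + Q + ⋯ + Q ^ (n - 1)`. -/
def geom (Q n : ℕ) : ℕ := ∑ i ∈ range n, Q ^ i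

@[simp] lemma geom_zero (Q : ℕ) : geom Q 0 = 0 := by simp [geom]

lemma geom_succ (Q n : ℕ) : geom Q (n + 1) = Q * geom Q n + 1 := geom_sum_succ

lemma geom_succ' (Q n : ℕ) : geom Q (n + 1) = geom Q n + Q ^ n := by
  simp [geom, sum_range_succ]

lemma geom_add (Q m n : ℕ) : geom Q (m + n) = geom Q m + Q ^ m * geom Q n := by
  induction n with
  | zero => simp
  | succ n ih => rw [← add_assoc, geom_succ', geom_succ', ih]; ring

lemma geom_mul (Q m n : ℕ) : geom Q (m * n) = geom Q m * geom (Q ^ m) n := by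
  induction n with
  | zero => simp
  | succ n ih => rw [Nat.mul_succ, geom_add, geom_succ', ih, pow_mul]; ring

lemma sub_one_mul_geom (Q n : ℕ) : ((Q : ℤ) - 1) * geom Q n = (Q : ℤ) ^ n - 1 := by
  rw [geom]; push_cast; exact mul_geom_sum _ _

/-- A groupless `F`-set, written intrinsically with multiplication by `Q` as Frobenius,
translated by all elements of a subgroup. -/
def IsFSet (Q : ℕ) (X : Set A) : Prop :=
  ∃ (r : ℕ) (a : A) (g : Fin r → A) (B : AddSubgroup A),
    X = {x | ∃ n : Fin r → ℕ, ∃ b ∈ B, x = a + ∑ i, geom Q (n i) • g i + b}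

/-- A finite union of `F`-sets. -/
def IsFSetUnion (Q : ℕ) (X : Set A) : Prop :=
  ∃ F : Set (Set A), F.Finite ∧ (∀ Y ∈ F, IsFSet Q Y) ∧ X = ⋃₀ F

lemma IsFSet.isFSetUnion {Q : ℕ} {X : Set A} (h : IsFSet Q X) : IsFSetUnion Q X :=
  ⟨{X}, Set.finite_singleton X, by simpa using h, by simp⟩

lemma IsFSetUnion.biUnion {Q : ℕ} {ι : Type*} {s : Set ι} (hs : s.Finite) {X : ι → Set A}
    (h : ∀ i ∈ s, IsFSetUnion Q (X i)) : IsFSetUnion Q (⋃ i ∈ s, X i) := by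
  choose! F hF hF' hX using h
  refine ⟨⋃ i ∈ s, F i, hs.biUnion hF, ?_, ?_⟩
  · simp only [Set.mem_iUnion]
    rintro Y ⟨i, hi, hY⟩
    exact hF' i hi Y hY
  · ext x
    simp only [Set.mem_iUnion, Set.mem_sUnion]
    constructor
    · rintro ⟨i, hi, hx⟩
      rw [hX i hi] at hx
      obtain ⟨Y, hY, hxY⟩ := hx
      exact ⟨Y, ⟨i, hi, hY⟩, hxY⟩
    · rintro ⟨Y, ⟨i, hi, hY⟩, hxY⟩
      exact ⟨i, hi, by rw [hX i hi]; exact ⟨Y, hY, hxY⟩⟩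

lemma IsFSetUnion.union {Q : ℕ} {X Y : Set A} (hX : IsFSetUnion Q X) (hY : IsFSetUnion Q Y) :
    IsFSetUnion Q (X ∪ Y) := by
  have := IsFSetUnion.biUnion (Q := Q) (X := fun b : Bool => cond b X Y)
    (Set.finite_univ (α := Bool)) (by rintro (_ | _) _ <;> assumption)
  rwa [Set.biUnion_univ, ← Set.union_eq_iUnion] at this

/-- An operation on sets that commutes with unions and sends `F`-sets to finite unions of
`F`-sets preserves finite unions of `F`-sets. -/
lemma IsFSetUnion.of_sUnion {Q Q' : ℕ} {A' : Type*} [AddCommGroup A'] {X : Set A}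
    (h : IsFSetUnion Q X) (f : Set A → Set A') (hf : ∀ F : Set (Set A), f (⋃₀ F) = ⋃ Y ∈ F, f Y)
    (h' : ∀ Y, IsFSet Q Y → IsFSetUnion Q' (f Y)) : IsFSetUnion Q' (f X) := by
  obtain ⟨F, hF, hFs, rfl⟩ := h
  rw [hf]
  exact IsFSetUnion.biUnion hF fun Y hY => h' Y (hFs Y hY)

lemma IsFSet.affine_image {Q : ℕ} {X : Set A} (h : IsFSet Q X) (a : A) (m : ℕ)
    (C : AddSubgroup A) :
    IsFSet Q {x | ∃ y ∈ X, ∃ c ∈ C, x = a + m • y + c} := by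
  obtain ⟨r, a₀, g, B, rfl⟩ := h
  refine ⟨r, a + m • a₀, fun i => m • g i, B.map (nsmulAddMonoidHom m) ⊔ C, ?_⟩
  ext x
  constructor
  · rintro ⟨_, ⟨n, b, hb, rfl⟩, c, hc, rfl⟩
    refine ⟨n, m • b + c, AddSubgroup.add_mem_sup (AddSubgroup.mem_map_of_mem _ hb) hc, ?_⟩
    simp only [smul_add, smul_sum, smul_comm m]
    abel
  · rintro ⟨n, b, hb, rfl⟩
    obtain ⟨_, ⟨b', hb', rfl⟩, c, hc, rfl⟩ := AddSubgroup.mem_sup.1 hb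
    refine ⟨_, ⟨n, b', hb', rfl⟩, c, hc, ?_⟩
    simp only [smul_add, smul_sum, smul_comm m, nsmulAddMonoidHom_apply]
    abel

lemma IsFSetUnion.affine_image {Q : ℕ} {X : Set A} (h : IsFSetUnion Q X) (a : A) (m : ℕ)
    (C : AddSubgroup A) :
    IsFSetUnion Q {x | ∃ y ∈ X, ∃ c ∈ C, x = a + m • y + c} := by
  refine h.of_sUnion (fun X => {x | ∃ y ∈ X, ∃ c ∈ C, x = a + m • y + c}) ?_
    fun Y hY => (hY.affine_image a m C).isFSetUnion
  intro F
  ext x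
  simp only [Set.mem_sUnion, Set.mem_ofPred_eq, Set.mem_iUnion]
  constructor
  · rintro ⟨y, ⟨Y, hY, hy⟩, h⟩
    exact ⟨Y, hY, y, hy, h⟩
  · rintro ⟨Y, hY, y, hy, h⟩
    exact ⟨y, ⟨Y, hY, hy⟩, h⟩

/-- Splitting exponents into residue classes modulo `k` replaces `Q` by `Q ^ k`. -/
lemma IsFSet.refine {Q : ℕ} {X : Set A} (h : IsFSet Q X) {k : ℕ} (hk : 1 ≤ k) :
    IsFSetUnion (Q ^ k) X := by
  obtain ⟨r, a, g, B, rfl⟩ := h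
  have key : ∀ (e : Fin r → ℕ) (n : Fin r → ℕ),
      ∑ i, geom Q (e i + k * n i) • g i
        = ∑ i, geom Q (e i) • g i
          + ∑ i, geom (Q ^ k) (n i) • ((Q ^ e i * geom Q k) • g i) := by
    intro e n
    rw [← sum_add_distrib]
    refine sum_congr rfl fun i _ => ?_
    rw [geom_add, geom_mul, smul_smul, ← add_smul]
    congr 1
    ring
  have : {x | ∃ n : Fin r → ℕ, ∃ b ∈ B, x = a + ∑ i, geom Q (n i) • g i + b}
      = ⋃ e ∈ (Set.univ : Set (Fin r → Fin k)),
        {x | ∃ n : Fin r → ℕ, ∃ b ∈ B, x = (a + ∑ i, geom Q (e i) • g i)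
          + ∑ i, geom (Q ^ k) (n i) • ((Q ^ (e i : ℕ) * geom Q k) • g i) + b} := by
    ext x
    simp only [Set.mem_ofPred_eq, Set.mem_iUnion, Set.mem_univ, exists_const]
    constructor
    · rintro ⟨n, b, hb, rfl⟩
      refine ⟨fun i => ⟨n i % k, Nat.mod_lt _ hk⟩, fun i => n i / k, b, hb, ?_⟩
      have h := key (fun i => n i % k) fun i => n i / k
      simp only [Nat.mod_add_div] at h
      rw [h, ← add_assoc]
    · rintro ⟨e, n, b, hb, rfl⟩
      refine ⟨fun i => e i + k * n i, b, hb, ?_⟩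
      rw [key, add_assoc a]
  rw [this]
  exact IsFSetUnion.biUnion Set.finite_univ fun e _ =>
    IsFSet.isFSetUnion ⟨r, _, _, B, rfl⟩

lemma IsFSetUnion.refine {Q : ℕ} {X : Set A} (h : IsFSetUnion Q X) {k : ℕ} (hk : 1 ≤ k) :
    IsFSetUnion (Q ^ k) X :=
  h.of_sUnion id (fun F => by simp [Set.sUnion_eq_biUnion]) fun _ hY => hY.refine hk

/-- A set which is a union of finitely many cosets of `B` is a finite union of `F`-sets. -/
lemma isFSetUnion_of_finite_quotient (Q : ℕ) {X : Set A} (B : AddSubgroup A)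
    (hB : ∀ x ∈ X, ∀ b ∈ B, x + b ∈ X)
    (hfin : (QuotientAddGroup.mk '' X : Set (A ⧸ B)).Finite) : IsFSetUnion Q X := by
  have : X = ⋃ z ∈ (QuotientAddGroup.mk '' X : Set (A ⧸ B)),
      {x | ∃ n : Fin 0 → ℕ, ∃ b ∈ B, x = z.out + ∑ i, geom Q (n i) • (Fin.elim0 i : A) + b} := by
    ext x
    simp only [Set.mem_iUnion, Set.mem_ofPred_eq, univ_eq_empty, sum_empty, add_zero]
    constructor
    · intro hx
      refine ⟨_, ⟨x, hx, rfl⟩, 0, -(x : A ⧸ B).out + x, ?_, by abel⟩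
      rw [← QuotientAddGroup.eq]
      exact QuotientAddGroup.out_eq' _
    · rintro ⟨_, ⟨y, hy, rfl⟩, -, b, hb, rfl⟩
      have : -y + (y : A ⧸ B).out ∈ B := by
        rw [← QuotientAddGroup.eq]
        exact (QuotientAddGroup.out_eq' _).symm
      have h := hB _ (hB y hy _ this) b hb
      rwa [add_neg_cancel_left] at h
  rw [this]
  exact IsFSetUnion.biUnion hfin fun z _ => IsFSet.isFSetUnion ⟨0, _, _, B, rfl⟩

/-- In a finitely generated abelian group only finitely many elements are divisible by all
powers of `Q ≥ 2`. -/
lemma finite_infinitely_divisible [Module.Finite ℤ A] {Q : ℕ} (hQ : 2 ≤ Q) :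
    {a : A | ∀ m : ℕ, ∃ a' : A, a = Q ^ m • a'}.Finite := by
  have htors : Module.IsTorsion ℤ (Submodule.torsion ℤ A) :=
    Submodule.torsion_isTorsion
  have : Finite (Submodule.torsion ℤ A) := Module.finite_of_fg_torsion _ htors
  refine Set.Finite.subset (Set.toFinite (Submodule.torsion ℤ A : Set A)) fun a ha => ?_
  have hmem : a ∈ ⨅ i : ℕ, (Ideal.span {(Q : ℤ)}) ^ i • (⊤ : Submodule ℤ A) := by
    rw [Submodule.mem_iInf]
    intro m
    obtain ⟨a', rfl⟩ := ha m
    have := Submodule.smul_mem_smul (Ideal.pow_mem_pow (Ideal.mem_span_singleton_self (Q : ℤ)) m)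
      (Submodule.mem_top (R := ℤ) (x := a'))
    rwa [← Nat.cast_pow, natCast_zsmul] at this
  obtain ⟨⟨r, hr⟩, hra⟩ := (Ideal.mem_iInf_smul_pow_eq_bot_iff _ a).1 hmem
  obtain ⟨s, rfl⟩ := Ideal.mem_span_singleton.1 hr
  have hne : (Q : ℤ) * s - 1 ≠ 0 := by
    intro h
    have h1 : (Q : ℤ) ∣ 1 := ⟨s, by linarith⟩
    have := Int.le_of_dvd one_pos h1
    omega
  refine (Submodule.mem_torsion_iff a).2 ⟨⟨_, mem_nonZeroDivisors_of_ne_zero hne⟩, ?_⟩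
  change ((Q : ℤ) * s - 1) • a = 0
  rw [sub_smul, one_smul, sub_eq_zero]
  exact hra

end FSets

section SelfSimilar

variable {A : Type*} [AddCommGroup A]

lemma forall_of_eventually_coordinatewise {r : ℕ} (m : ℕ) (P : (Fin r → ℕ) → Prop)
    (hP : ∀ n i, (∀ j ≥ m, P (Function.update n i j)) → ∀ j, P (Function.update n i j))
    (h : ∀ n, (∀ i, m ≤ n i) → P n) (n : Fin r → ℕ) : P n := by
  have key : ∀ (s : Finset (Fin r)) (n : Fin r → ℕ), (∀ i ∉ s, m ≤ n i) → P n := by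
    intro s
    induction s using Finset.induction_on with
    | empty => exact fun n hn => h n fun i => hn i (by simp)
    | insert i s _ ih =>
      intro n hn
      have := hP n i (fun j hj => ih _ fun i' hi' => ?_) (n i)
      · rwa [Function.update_eq_self] at this
      · rcases eq_or_ne i' i with rfl | hne
        · simpa using hj
        · rw [Function.update_of_ne hne]
          exact hn i' (by simp [hne, hi'])
  exact key univ n (by simp)

lemma nsmul_geom_fset_eq (Q m : ℕ) {r : ℕ} (δ a b : A) (g : Fin r → A) (n : Fin r → ℕ) :
    geom Q m • δ + Q ^ m • (a + ∑ i, geom Q (n i) • g i + b)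
      = a + ∑ i : Fin (r + 1), geom Q (Fin.cons (α := fun _ => ℕ) m (fun i => m + n i) i) •
          Fin.cons (α := fun _ => A) (δ + ((Q : ℤ) - 1) • a - ∑ i, g i) g i + Q ^ m • b := by
  have h : ∑ i, geom Q (m + n i) • g i
      = geom Q m • ∑ i, g i + Q ^ m • ∑ i, geom Q (n i) • g i := by
    simp only [geom_add, add_smul, mul_smul, sum_add_distrib, smul_sum]
  have h' : geom Q m • ((Q : ℤ) - 1) • a = Q ^ m • a - a := by
    rw [← natCast_zsmul _ (geom Q m), smul_smul, mul_comm, sub_one_mul_geom, sub_smul, one_smul,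
      ← Nat.cast_pow, natCast_zsmul]
  rw [Fin.sum_univ_succ]
  simp only [Fin.cons_zero, Fin.cons_succ]
  rw [h, smul_sub, smul_add (geom Q m), h', smul_add, smul_add]
  abel

/-- The union of the images of an `F`-set in `X` under the iterates of the self-similarity
`x ↦ δ + Q x` is covered by an `F`-set in `X`. -/
lemma exists_fset_iterates {Q : ℕ} {X Y : Set A} (B : AddSubgroup A) (δ : A)
    (hB : ∀ x ∈ X, ∀ b ∈ B, x + b ∈ X)
    (hext : ∀ (a g : A) (m : ℕ), (∀ n ≥ m, a + geom Q n • g ∈ X) → ∀ n, a + geom Q n • g ∈ X)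
    (hgrp : ∀ (a : A) (C : AddSubgroup A) (m : ℕ), (∀ c ∈ C, a + Q ^ m • c ∈ X) →
      ∀ c ∈ C, a + c ∈ X)
    (hδ : ∀ m, ∀ x ∈ X, geom Q m • δ + Q ^ m • x ∈ X)
    (hY : IsFSet Q Y) (hYX : Y ⊆ X) :
    ∃ Z : Set A, IsFSet Q Z ∧ Z ⊆ X ∧
      ∀ m, ∀ y ∈ Y, ∀ b ∈ B, geom Q m • δ + Q ^ m • y + b ∈ Z := by
  obtain ⟨r, a, g, C, rfl⟩ := hY
  set g' : Fin (r + 1) → A := Fin.cons (δ + ((Q : ℤ) - 1) • a - ∑ i, g i) g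
  refine ⟨_, ⟨r + 1, a, g', C ⊔ B, rfl⟩, ?_, ?_⟩
  · rintro _ ⟨n, d, hd, rfl⟩
    obtain ⟨c, hc, b, hb, rfl⟩ := AddSubgroup.mem_sup.1 hd
    rw [← add_assoc]
    refine hB _ ?_ b hb
    have hfirst : ∀ (m : ℕ) (n : Fin r → ℕ), (∀ i, m ≤ n i) →
        a + ∑ i, geom Q (Fin.cons (α := fun _ => ℕ) m n i) • g' i + c ∈ X := by
      intro m n hn
      refine hgrp _ C m (fun c hc => ?_) c hc
      have := hδ m _ (hYX ⟨fun i => n i - m, c, hc, rfl⟩)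
      rw [nsmul_geom_fset_eq] at this
      simpa only [Nat.add_sub_cancel' (hn _)] using this
    have hsecond := forall_of_eventually_coordinatewise (n 0)
      (fun n' => a + ∑ i, geom Q (Fin.cons (α := fun _ => ℕ) (n 0) n' i) • g' i + c ∈ X)
      (fun n' i h => ?_) (hfirst (n 0)) (Fin.tail n)
    · rwa [Fin.cons_self_tail] at hsecond
    · have hsplit : ∀ j, a + ∑ l, geom Q (Fin.cons (α := fun _ => ℕ) (n 0)
          (Function.update n' i j) l) • g' l + c
          = (a + geom Q (n 0) • g' 0 + ∑ l ∈ univ.erase i, geom Q (n' l) • g' l.succ + c)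
            + geom Q j • g' i.succ := by
        intro j
        rw [Fin.sum_univ_succ, ← add_sum_erase _ _ (mem_univ i)]
        simp only [Fin.cons_zero, Fin.cons_succ, Function.update_self]
        rw [sum_congr rfl fun l hl => by rw [Function.update_of_ne (ne_of_mem_erase hl)]]
        abel
      simp only [hsplit] at h ⊢
      exact hext _ _ (n 0) h
  · rintro m _ ⟨n, c, hc, rfl⟩ b hb
    refine ⟨Fin.cons m fun i => m + n i, Q ^ m • c + b,
      AddSubgroup.add_mem_sup (C.nsmul_mem hc _) hb, ?_⟩
    rw [nsmul_geom_fset_eq, add_assoc]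

lemma isFSetUnion_of_self_similar [Module.Finite ℤ A] {Q : ℕ} (hQ : 2 ≤ Q) {X Y : Set A}
    (B : AddSubgroup A) (δ : A)
    (hB : ∀ x ∈ X, ∀ b ∈ B, x + b ∈ X)
    (hext : ∀ (a g : A) (m : ℕ), (∀ n ≥ m, a + geom Q n • g ∈ X) → ∀ n, a + geom Q n • g ∈ X)
    (hgrp : ∀ (a : A) (C : AddSubgroup A) (m : ℕ), (∀ c ∈ C, a + Q ^ m • c ∈ X) →
      ∀ c ∈ C, a + c ∈ X)
    (hδ : ∀ x ∈ X, δ + Q • x ∈ X) (hY : IsFSetUnion Q Y) (hYX : Y ⊆ X)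
    (hX : ∀ x ∈ X, x ∈ Y ∨ ∃ y ∈ X, ∃ b ∈ B, x = δ + Q • y + b) :
    IsFSetUnion Q X := by
  have hstep : ∀ (m : ℕ) (x : A), geom Q m • δ + Q ^ m • (δ + Q • x)
      = geom Q (m + 1) • δ + Q ^ (m + 1) • x := by
    intro m x
    rw [geom_succ', add_smul, pow_succ, mul_smul, smul_add, add_assoc]
  have hδm : ∀ m, ∀ x ∈ X, geom Q m • δ + Q ^ m • x ∈ X := by
    intro m
    induction m with
    | zero => simp
    | succ m ih =>
      intro x hx
      rw [← hstep]
      exact ih _ (hδ x hx)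
  obtain ⟨F, hF, hFs, rfl⟩ := hY
  have hZ : ∀ Y ∈ F, ∃ Z : Set A, IsFSet Q Z ∧ Z ⊆ X ∧
      ∀ m, ∀ y ∈ Y, ∀ b ∈ B, geom Q m • δ + Q ^ m • y + b ∈ Z := fun Y hY =>
    exists_fset_iterates B δ hB hext hgrp hδm (hFs Y hY) fun y hy => hYX ⟨Y, hY, hy⟩
  choose! Z hZF hZX hZm using hZ
  set R : Set A := {x ∈ X | ∀ m, ∃ y ∈ X, ∃ b ∈ B, x = geom Q m • δ + Q ^ m • y + b}
  have hRB : ∀ x ∈ R, ∀ b ∈ B, x + b ∈ R := by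
    rintro x ⟨hx, hxm⟩ b hb
    refine ⟨hB x hx b hb, fun m => ?_⟩
    obtain ⟨y, hy, b', hb', h⟩ := hxm m
    exact ⟨y, hy, b' + b, B.add_mem hb' hb, by rw [h, add_assoc]⟩
  have hRfin : (QuotientAddGroup.mk '' R : Set (A ⧸ B)).Finite := by
    rcases R.eq_empty_or_nonempty with h | ⟨x₀, -, hx₀⟩
    · simp [h]
    have hfin : Module.Finite ℤ (A ⧸ B) :=
      Module.Finite.of_surjective (QuotientAddGroup.mk' B).toIntLinearMap
        (QuotientAddGroup.mk'_surjective B)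
    refine ((finite_infinitely_divisible (A := A ⧸ B) hQ).image
      (fun z => z + (x₀ : A ⧸ B))).subset ?_
    rintro _ ⟨x, ⟨-, hx⟩, rfl⟩
    refine ⟨(x : A ⧸ B) - x₀, fun m => ?_, by simp⟩
    obtain ⟨y, -, b, hb, hy⟩ := hx m
    obtain ⟨y₀, -, b₀, hb₀, hy₀⟩ := hx₀ m
    refine ⟨((y - y₀ : A) : A ⧸ B), ?_⟩
    rw [← QuotientAddGroup.mk_sub, ← QuotientAddGroup.mk_nsmul, QuotientAddGroup.eq]
    have : -(x - x₀) + Q ^ m • (y - y₀) = b₀ - b := by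
      rw [hy, hy₀, smul_sub]
      abel
    rw [this]
    exact B.sub_mem hb₀ hb
  have hdich : ∀ x ∈ X, ∀ m, (∃ j, ∃ y ∈ ⋃₀ F, ∃ b ∈ B, x = geom Q j • δ + Q ^ j • y + b) ∨
      ∃ y ∈ X, ∃ b ∈ B, x = geom Q m • δ + Q ^ m • y + b := by
    intro x hx m
    induction m with
    | zero => exact Or.inr ⟨x, hx, 0, B.zero_mem, by simp⟩
    | succ m ih =>
      rcases ih with h | ⟨y, hy, b, hb, rfl⟩
      · exact Or.inl h
      rcases hX y hy with hyF | ⟨z, hz, b', hb', rfl⟩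
      · exact Or.inl ⟨m, y, hyF, b, hb, rfl⟩
      · refine Or.inr ⟨z, hz, Q ^ m • b' + b, B.add_mem (B.nsmul_mem hb' _) hb, ?_⟩
        rw [← hstep, smul_add (Q ^ m) (δ + Q • z)]
        abel
  have hXeq : X = (⋃ Y ∈ F, Z Y) ∪ R := by
    apply Set.Subset.antisymm
    · intro x hx
      by_cases h : ∃ j, ∃ y ∈ ⋃₀ F, ∃ b ∈ B, x = geom Q j • δ + Q ^ j • y + b
      · obtain ⟨j, y, ⟨Y, hY, hy⟩, b, hb, rfl⟩ := h
        exact Or.inl (Set.mem_biUnion hY (hZm Y hY j y hy b hb))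
      · exact Or.inr ⟨hx, fun m => (hdich x hx m).resolve_left h⟩
    · exact Set.union_subset (Set.iUnion₂_subset hZX) fun x hx => hx.1
  rw [hXeq]
  exact (IsFSetUnion.biUnion hF fun Y hY => (hZF Y hY).isFSetUnion).union
    (isFSetUnion_of_finite_quotient Q B hRB hRfin)

end SelfSimilar

section Frobenius

variable {L : Type*} [Field L] (p : ℕ) [Fact p.Prime] [CharP L p] {S : Type*} [Fintype S]

/-- Twisting by Frobenius preserves linear independence of vectors in `S → L`. -/
lemma linearIndependent_mul_frobenius {ι : Type*} [Fintype ι] {t : ι → S → L}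
    (ht : LinearIndependent L t) {u : S → L} (hu : ∀ s, u s ≠ 0) (n : ℕ) :
    LinearIndependent L fun i => u * t i ^ p ^ n := by
  classical
  obtain ⟨G, hG⟩ := LinearMap.exists_leftInverse_of_injective (Fintype.linearCombination L t)
    (LinearMap.ker_eq_bot.2 ht.fintypeLinearCombination_injective)
  have hGt : ∀ i j, ∑ s, t i s * G (Pi.single s 1) j = if i = j then 1 else 0 := by
    intro i j
    have h1 : G (t i) = Pi.single i 1 := by
      have := LinearMap.congr_fun hG (Pi.single i 1)
      simpa using this
    have h2 : G (t i) j = ∑ s, t i s * G (Pi.single s 1) j := by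
      conv_lhs => rw [pi_eq_sum_univ' (t i)]
      simp [Finset.sum_apply]
    rw [← h2, h1, Pi.single_apply]
    simp [eq_comm]
  rw [Fintype.linearIndependent_iff]
  intro c hc j
  have hc' : ∀ s, ∑ i, c i * t i s ^ p ^ n = 0 := by
    intro s
    have := congrFun hc s
    simp only [Finset.sum_apply, Pi.smul_apply, Pi.mul_apply, Pi.pow_apply, smul_eq_mul,
      Pi.zero_apply] at this
    have h : u s * ∑ i, c i * t i s ^ p ^ n = 0 := by
      rw [← this, mul_sum]
      exact sum_congr rfl fun i _ => by ring
    exact (mul_eq_zero.1 h).resolve_left (hu s)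
  have hexp : ExpChar L p := ExpChar.prime Fact.out
  calc c j = ∑ i, c i * (∑ s, t i s * G (Pi.single s 1) j) ^ p ^ n := by
        simp only [hGt]
        rw [sum_eq_single j] <;> simp +contextual [(Fact.out : p.Prime).ne_zero]
    _ = ∑ i, c i * ∑ s, (t i s * G (Pi.single s 1) j) ^ p ^ n := by
        simp only [sum_pow_char_pow]
    _ = ∑ s, (∑ i, c i * t i s ^ p ^ n) * G (Pi.single s 1) j ^ p ^ n := by
        simp only [mul_sum, sum_mul]
        rw [sum_comm]
        refine sum_congr rfl fun s _ => sum_congr rfl fun i _ => ?_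
        ring
    _ = 0 := by simp [hc']

/-- If a Frobenius twist maps `T` into its own span, the image of `T` spans that span. -/
lemma mem_of_forall_mul_frobenius_mem {T : Set (S → L)} {u : S → L} (hu : ∀ s, u s ≠ 0) {n : ℕ}
    (hT : ∀ t ∈ T, u * t ^ p ^ n ∈ Submodule.span L T) {W : Submodule L (S → L)}
    (hW : ∀ t ∈ T, u * t ^ p ^ n ∈ W) : ∀ t ∈ T, t ∈ W := by
  obtain ⟨b, hbT, hbspan, hb⟩ := exists_linearIndependent L T
  have : Fintype b := have := hb.finite; Fintype.ofFinite b
  have hf := linearIndependent_mul_frobenius p hb hu n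
  have hle : Submodule.span L (Set.range fun i : b => u * (i : S → L) ^ p ^ n)
      ≤ Submodule.span L T := by
    rw [Submodule.span_le]
    rintro _ ⟨i, rfl⟩
    exact hT _ (hbT i.2)
  have heq := Submodule.eq_of_le_of_finrank_eq hle (by
    have h := finrank_span_eq_card hb
    rw [Subtype.range_coe, hbspan] at h
    rw [finrank_span_eq_card hf, h])
  intro t ht
  have htm : t ∈ Submodule.span L (Set.range fun i : b => u * (i : S → L) ^ p ^ n) := by
    rw [heq]
    exact Submodule.subset_span ht
  refine Submodule.span_le.2 ?_ htm
  rintro _ ⟨i, rfl⟩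
  exact hW _ (hbT i.2)

end Frobenius

section Pullback

variable {L : Type*} [Field L] (p : ℕ) [Fact p.Prime] [CharP L p] {S : Type*}
  {A : Type*} [AddCommGroup A] (χ : AddChar A (S → L))

lemma addChar_apply_ne_zero (a : A) (s : S) : χ a s ≠ 0 := by
  have h := congrFun (χ.map_add_eq_mul a (-a)) s
  rw [add_neg_cancel, χ.map_zero_eq_one, Pi.mul_apply] at h
  exact left_ne_zero_of_mul_eq_one h.symm

/-- The subspace of all `v` with `χ x * v ^ (p ^ n) ∈ V`. -/
def pullback (V : Submodule L (S → L)) (x : A) (n : ℕ) : Submodule L (S → L) where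
  carrier := {v | χ x * v ^ p ^ n ∈ V}
  zero_mem' := by
    have : (0 : S → L) ^ p ^ n = 0 := zero_pow (pow_ne_zero _ (Fact.out : p.Prime).ne_zero)
    simp [this]
  add_mem' := by
    intro v w hv hw
    have : (v + w) ^ p ^ n = v ^ p ^ n + w ^ p ^ n := by
      ext s
      exact add_pow_char_pow (v s) (w s) p n
    change χ x * (v + w) ^ p ^ n ∈ V
    rw [this, mul_add]
    exact V.add_mem hv hw
  smul_mem' := by
    intro c v hv
    change χ x * (c • v) ^ p ^ n ∈ V
    rw [smul_pow, mul_smul_comm]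
    exact V.smul_mem _ hv

variable {p χ}

lemma mem_pullback {V : Submodule L (S → L)} {x : A} {n : ℕ} {v : S → L} :
    v ∈ pullback p χ V x n ↔ χ x * v ^ p ^ n ∈ V := Iff.rfl

lemma pullback_zero (V : Submodule L (S → L)) : pullback p χ V 0 0 = V := by
  ext v
  simp [mem_pullback]

lemma pullback_pullback (V : Submodule L (S → L)) (x y : A) (m n : ℕ) :
    pullback p χ (pullback p χ V x n) y m = pullback p χ V (x + p ^ n • y) (n + m) := by
  ext v
  simp only [mem_pullback]
  rw [χ.map_add_eq_mul, χ.map_nsmul_eq_pow, mul_pow, ← pow_mul, ← pow_add, mul_assoc, add_comm m]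

lemma pullback_geom {V : Submodule L (S → L)} {x : A} {n : ℕ} (h : pullback p χ V x n = V)
    (k : ℕ) : pullback p χ V (geom (p ^ n) k • x) (n * k) = V := by
  induction k with
  | zero => simp [pullback_zero]
  | succ k ih =>
    have := pullback_pullback (p := p) (χ := χ) V (geom (p ^ n) k • x) x n (n * k)
    rw [ih, h] at this
    rw [geom_succ', add_smul, ← pow_mul, Nat.mul_succ, ← this]

variable (χ) in
/-- The stabilizer in `A` of a subspace. -/
def stabilizer (V : Submodule L (S → L)) : AddSubgroup A where
  carrier := {b | ∀ v, χ b * v ∈ V ↔ v ∈ V}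
  zero_mem' := by simp
  add_mem' := by
    intro a b ha hb v
    rw [χ.map_add_eq_mul, mul_assoc, ha, hb]
  neg_mem' := by
    intro a ha v
    rw [← ha, ← mul_assoc, ← χ.map_add_eq_mul, add_neg_cancel, χ.map_zero_eq_one, one_mul]

lemma exists_representatives_pow {Ω : Set (Submodule L (S → L))} {R : Set A} (hRfin : R.Finite)
    (hR : ∀ a : A, ∃ x ∈ R, ∃ y, a = x + p • y)
    (hΩ : ∀ V ∈ Ω, ∀ x ∈ R, pullback p χ V x 1 ∈ Ω) (n : ℕ) :
    ∃ R' : Set A, R'.Finite ∧ (∀ a : A, ∃ x ∈ R', ∃ y, a = x + p ^ n • y) ∧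
      ∀ V ∈ Ω, ∀ x ∈ R', pullback p χ V x n ∈ Ω := by
  induction n with
  | zero =>
    exact ⟨{0}, Set.finite_singleton 0, fun a => ⟨0, rfl, a, by simp⟩,
      fun V hV x hx => by rw [Set.mem_singleton_iff.1 hx, pullback_zero]; exact hV⟩
  | succ n ih =>
    obtain ⟨R', hR'fin, hR', hΩ'⟩ := ih
    refine ⟨Set.image2 (fun x y => x + p ^ n • y) R' R, hR'fin.image2 _ hRfin, ?_, ?_⟩
    · intro a
      obtain ⟨x, hx, y, rfl⟩ := hR' a
      obtain ⟨z, hz, w, rfl⟩ := hR y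
      exact ⟨_, ⟨x, hx, z, hz, rfl⟩, w, by rw [pow_succ, mul_smul, smul_add, add_assoc]⟩
    · rintro V hV _ ⟨x, hx, y, hy, rfl⟩
      rw [← pullback_pullback]
      exact hΩ _ (hΩ' V hV x hx) y hy

variable [Fintype S]

lemma mul_mem_of_pullback_eq {V : Submodule L (S → L)} {x y : A} {n : ℕ}
    (hx : pullback p χ V x n = V) (hy : pullback p χ V y n = V) :
    ∀ v ∈ V, χ (x - y) * v ∈ V := by
  have h := mem_of_forall_mul_frobenius_mem p (T := (V : Set (S → L))) (u := χ y) (n := n)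
    (W := pullback p χ V (x - y) 0) (addChar_apply_ne_zero χ y) ?_ ?_
  · intro v hv
    simpa [mem_pullback] using h v hv
  · intro t ht
    rw [Submodule.span_eq]
    exact mem_pullback.1 (hy.symm ▸ ht)
  · intro t ht
    rw [mem_pullback, pow_zero, pow_one, ← mul_assoc, ← χ.map_add_eq_mul, sub_add_cancel]
    exact mem_pullback.1 (hx.symm ▸ ht)

lemma sub_mem_stabilizer {V : Submodule L (S → L)} {x y : A} {n : ℕ}
    (hx : pullback p χ V x n = V) (hy : pullback p χ V y n = V) : x - y ∈ stabilizer χ V := by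
  refine fun v => ⟨fun h => ?_, mul_mem_of_pullback_eq hx hy v⟩
  have := mul_mem_of_pullback_eq hy hx _ h
  rwa [← mul_assoc, ← χ.map_add_eq_mul, sub_add_sub_cancel, sub_self, χ.map_zero_eq_one,
    one_mul] at this

lemma forall_mem_of_eventually_mem {V : Submodule L (S → L)} {k : ℕ} (a g : A) (m : ℕ)
    (h : ∀ n ≥ m, χ (a + geom (p ^ k) n • g) ∈ V) (n : ℕ) : χ (a + geom (p ^ k) n • g) ∈ V := by
  induction m with
  | zero => exact h n n.zero_le
  | succ m ih =>
    refine ih ?_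
    set T : Set (S → L) := {t | ∃ n ≥ m, t = χ (geom (p ^ k) n • g)}
    have hmul : ∀ n, χ g * χ (geom (p ^ k) n • g) ^ p ^ k = χ (geom (p ^ k) (n + 1) • g) := by
      intro n
      rw [← χ.map_nsmul_eq_pow, ← χ.map_add_eq_mul, geom_succ, add_smul, mul_smul, one_smul,
        add_comm]
    have hT := mem_of_forall_mul_frobenius_mem p (T := T) (u := χ g) (n := k)
      (W := pullback p χ V a 0) (addChar_apply_ne_zero χ g) ?_ ?_
    · intro n hn
      rw [χ.map_add_eq_mul]
      simpa [mem_pullback] using hT _ ⟨n, hn, rfl⟩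
    · rintro _ ⟨n, hn, rfl⟩
      rw [hmul]
      exact Submodule.subset_span ⟨n + 1, by omega, rfl⟩
    · rintro _ ⟨n, hn, rfl⟩
      rw [hmul, mem_pullback, pow_zero, pow_one, ← χ.map_add_eq_mul]
      exact h _ (by omega)

lemma forall_mem_of_nsmul_mem {V : Submodule L (S → L)} {k : ℕ} (a : A) (C : AddSubgroup A)
    (h : ∀ c ∈ C, χ (a + p ^ k • c) ∈ V) : ∀ c ∈ C, χ (a + c) ∈ V := by
  have hT := mem_of_forall_mul_frobenius_mem p (T := χ '' C) (u := 1) (n := k)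
    (W := pullback p χ V a 0) (fun _ => one_ne_zero) ?_ ?_
  · intro c hc
    rw [χ.map_add_eq_mul]
    simpa [mem_pullback] using hT _ ⟨c, hc, rfl⟩
  · rintro _ ⟨c, hc, rfl⟩
    rw [one_mul, ← χ.map_nsmul_eq_pow]
    exact Submodule.subset_span ⟨_, C.nsmul_mem hc _, rfl⟩
  · rintro _ ⟨c, hc, rfl⟩
    rw [one_mul, ← χ.map_nsmul_eq_pow, mem_pullback, pow_zero, pow_one, ← χ.map_add_eq_mul]
    exact h c hc

end Pullback

section Descent

lemma exists_isFSetUnion_biUnion {A : Type*} [AddCommGroup A] (p : ℕ) {ι : Type*} {s : Set ι}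
    (hs : s.Finite) {X : ι → Set A} (h : ∀ i ∈ s, ∃ k, 1 ≤ k ∧ IsFSetUnion (p ^ k) (X i)) :
    ∃ k, 1 ≤ k ∧ IsFSetUnion (p ^ k) (⋃ i ∈ s, X i) := by
  classical
  choose! k hk hX using h
  refine ⟨∏ i ∈ hs.toFinset, k i, ?_, IsFSetUnion.biUnion hs fun i hi => ?_⟩
  · exact Nat.one_le_iff_ne_zero.2 (prod_ne_zero_iff.2 fun i hi =>
      Nat.one_le_iff_ne_zero.1 (hk i (hs.mem_toFinset.1 hi)))
  · rw [← mul_prod_erase _ _ (hs.mem_toFinset.2 hi), pow_mul]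
    refine (hX i hi).refine (Nat.one_le_iff_ne_zero.2 (prod_ne_zero_iff.2 fun j hj => ?_))
    exact Nat.one_le_iff_ne_zero.1 (hk j (hs.mem_toFinset.1 (mem_of_mem_erase hj)))

variable {L : Type*} [Field L] {p : ℕ} [Fact p.Prime] [CharP L p] {S : Type*} [Fintype S]
  {A : Type*} [AddCommGroup A] [Module.Finite ℤ A] {χ : AddChar A (S → L)}

/-- The case of a subspace that recurs under pullback: if all elements outside one class modulo
`p ^ n` and the stabilizer are known to lie in the finite union `Y` of `F`-sets, then the whole
preimage of `V` is a finite union of `F`-sets. -/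
lemma exists_isFSetUnion_of_pullback_eq {V : Submodule L (S → L)} {δ : A} {n k : ℕ} (hn : 1 ≤ n)
    (hk : 1 ≤ k) (hδ : pullback p χ V δ n = V) {Y : Set A} (hY : IsFSetUnion (p ^ k) Y)
    (hYV : ∀ y ∈ Y, χ y ∈ V)
    (hX : ∀ x, χ x ∈ V → x ∈ Y ∨ ∃ y, ∃ b ∈ stabilizer χ V, x = δ + p ^ n • y + b) :
    ∃ l, 1 ≤ l ∧ IsFSetUnion (p ^ l) {x | χ x ∈ V} := by
  set B := stabilizer χ V
  have hB : ∀ x, χ x ∈ V → ∀ b ∈ B, χ (x + b) ∈ V := by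
    intro x hx b hb
    rw [add_comm, χ.map_add_eq_mul]
    exact (hb _).2 hx
  have hpull : ∀ {x : A} {m : ℕ}, pullback p χ V x m = V → ∀ y, χ (x + p ^ m • y) ∈ V ↔ χ y ∈ V := by
    intro x m hx y
    conv_rhs => rw [← hx, mem_pullback, ← χ.map_nsmul_eq_pow, ← χ.map_add_eq_mul]
  have hX' : ∀ x, χ x ∈ V → x ∈ Y ∨ ∃ y, χ y ∈ V ∧ ∃ b ∈ B, x = δ + p ^ n • y + b := by
    intro x hx
    refine (hX x hx).imp_right ?_
    rintro ⟨y, b, hb, rfl⟩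
    refine ⟨y, ?_, b, hb, rfl⟩
    have := hB _ hx _ (B.neg_mem hb)
    rwa [add_neg_cancel_right, hpull hδ] at this
  have hstep : ∀ (j : ℕ) (x : A), geom (p ^ n) j • δ + p ^ (n * j) • (δ + p ^ n • x)
      = geom (p ^ n) (j + 1) • δ + p ^ (n * (j + 1)) • x := by
    intro j x
    rw [geom_succ', add_smul, Nat.mul_succ, pow_add, mul_smul, smul_add, add_assoc, pow_mul]
  have hiter : ∀ (j : ℕ) (x : A), χ x ∈ V →
      (∃ i < j, ∃ y ∈ Y, ∃ b ∈ B, x = geom (p ^ n) i • δ + p ^ (n * i) • y + b) ∨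
      ∃ y, χ y ∈ V ∧ ∃ b ∈ B, x = geom (p ^ n) j • δ + p ^ (n * j) • y + b := by
    intro j x hx
    induction j with
    | zero => exact Or.inr ⟨x, hx, 0, B.zero_mem, by simp⟩
    | succ j ih =>
      rcases ih with ⟨i, hi, h⟩ | ⟨y, hy, b, hb, rfl⟩
      · exact Or.inl ⟨i, by omega, h⟩
      rcases hX' y hy with hyY | ⟨z, hz, b', hb', rfl⟩
      · exact Or.inl ⟨j, by omega, y, hyY, b, hb, rfl⟩
      · refine Or.inr ⟨z, hz, p ^ (n * j) • b' + b, B.add_mem (B.nsmul_mem hb' _) hb, ?_⟩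
        rw [← hstep, smul_add _ (δ + p ^ n • z)]
        abel
  have hY' : IsFSetUnion (p ^ (n * k)) (⋃ i ∈ Set.Iio k,
      {x | ∃ y ∈ Y, ∃ b ∈ B, x = geom (p ^ n) i • δ + p ^ (n * i) • y + b}) := by
    rw [mul_comm, pow_mul]
    exact (IsFSetUnion.biUnion (Set.finite_Iio k) fun i _ => hY.affine_image _ _ _).refine hn
  have hδk := pullback_geom hδ k
  have hnk : n * k ≠ 0 := Nat.mul_ne_zero (by omega) (by omega)
  refine ⟨n * k, Nat.one_le_iff_ne_zero.2 hnk, isFSetUnion_of_self_similar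
    (le_trans (Fact.out : p.Prime).two_le (Nat.le_self_pow hnk p)) B (geom (p ^ n) k • δ)
    hB (fun a g m h => forall_mem_of_eventually_mem a g m h)
    (fun a C m h => forall_mem_of_nsmul_mem (p := p) (k := n * k * m) a C ?_)
    (fun x hx => (hpull hδk x).2 hx) hY' ?_ ?_⟩
  · rw [pow_mul]
    exact h
  · intro x hx
    simp only [Set.mem_iUnion] at hx
    obtain ⟨i, -, y, hy, b, hb, rfl⟩ := hx
    exact hB _ ((hpull (pullback_geom hδ i) y).2 (hYV y hy)) b hb
  · intro x hx
    rcases hiter k x hx with ⟨i, hi, h⟩ | h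
    · exact Or.inl (Set.mem_biUnion (Set.mem_Iio.2 hi) h)
    · exact Or.inr h

/-- If finitely many subspaces are permuted among themselves by pullback along representatives
modulo `p`, then their preimages in `A` are finite unions of `F`-sets. -/
theorem exists_isFSetUnion_of_finite_pullbacks {Ω : Set (Submodule L (S → L))} (hΩfin : Ω.Finite)
    {R : Set A} (hRfin : R.Finite) (hR : ∀ a : A, ∃ x ∈ R, ∃ y, a = x + p • y)
    (hΩ : ∀ V ∈ Ω, ∀ x ∈ R, pullback p χ V x 1 ∈ Ω) :
    ∀ V ∈ Ω, ∃ k, 1 ≤ k ∧ IsFSetUnion (p ^ k) {x | χ x ∈ V} := by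
  set reach : Submodule L (S → L) → Set (Submodule L (S → L)) :=
    fun V => {W ∈ Ω | ∃ x n, pullback p χ V x n = W}
  intro V hV
  induction h : (reach V).ncard using Nat.strong_induction_on generalizing V with
  | _ N ih =>
  subst h
  have hlower : ∀ x n, pullback p χ V x n ∈ Ω → V ∉ reach (pullback p χ V x n) →
      ∃ k, 1 ≤ k ∧ IsFSetUnion (p ^ k) {y | χ y ∈ pullback p χ V x n} := by
    intro x n hx hVx
    refine ih _ (Set.ncard_lt_ncard ?_ (hΩfin.subset fun W hW => hW.1)) _ hx rfl
    refine ⟨?_, fun hsub => hVx (hsub ⟨hV, 0, 0, pullback_zero V⟩)⟩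
    rintro _ ⟨hW, y, m, rfl⟩
    refine ⟨hW, x + p ^ n • y, n + m, (pullback_pullback V x y m n).symm⟩
  have hpieces : ∀ (n : ℕ) (T : Set A), T.Finite → (∀ x ∈ T, pullback p χ V x n ∈ Ω) →
      (∀ x ∈ T, V ∉ reach (pullback p χ V x n)) → ∃ k, 1 ≤ k ∧ IsFSetUnion (p ^ k)
      (⋃ x ∈ T, {a | ∃ y ∈ {y | χ y ∈ pullback p χ V x n}, ∃ c ∈ (⊥ : AddSubgroup A),
        a = x + p ^ n • y + c}) := by
    intro n T hT h1 h2
    refine exists_isFSetUnion_biUnion p hT fun x hx => ?_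
    obtain ⟨k, hk, h⟩ := hlower x n (h1 x hx) (h2 x hx)
    exact ⟨k, hk, h.affine_image _ _ _⟩
  have hmem : ∀ x n y, χ y ∈ pullback p χ V x n ↔ χ (x + p ^ n • y) ∈ V := by
    intro x n y
    rw [mem_pullback, ← χ.map_nsmul_eq_pow, ← χ.map_add_eq_mul]
  by_cases hcyc : ∃ n δ, 1 ≤ n ∧ pullback p χ V δ n = V
  · obtain ⟨n, δ, hn, hδ⟩ := hcyc
    obtain ⟨R', hR'fin, hR', hΩ'⟩ := exists_representatives_pow hRfin hR hΩ n
    obtain ⟨k, hk, hY⟩ := hpieces n {x ∈ R' | V ∉ reach (pullback p χ V x n)}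
      (hR'fin.subset fun x hx => hx.1) (fun x hx => hΩ' V hV x hx.1) fun x hx => hx.2
    refine exists_isFSetUnion_of_pullback_eq hn hk hδ hY ?_ ?_
    · intro a ha
      simp only [Set.mem_iUnion] at ha
      obtain ⟨x, -, y, hy, c, hc, rfl⟩ := ha
      rw [AddSubgroup.mem_bot.1 hc, add_zero]
      exact (hmem x n y).1 hy
    · intro a ha
      obtain ⟨x, hx, y, rfl⟩ := hR' a
      by_cases hr : V ∈ reach (pullback p χ V x n)
      · right
        obtain ⟨-, z, m, hz⟩ := hr
        rw [pullback_pullback] at hz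
        have h1 := pullback_geom hz n
        have h2 := pullback_geom hδ (n + m)
        rw [mul_comm] at h2
        have hst := sub_mem_stabilizer h1 h2
        obtain ⟨i, rfl⟩ := Nat.exists_eq_succ_of_ne_zero (Nat.one_le_iff_ne_zero.1 hn)
        rw [Nat.succ_eq_add_one] at *
        rw [geom_succ, show i + 1 + m = i + m + 1 by omega, geom_succ] at hst
        refine ⟨y + geom (p ^ (i + 1)) (i + m) • δ - z
          - (p ^ m * geom (p ^ (i + 1 + m)) i) • (x + p ^ (i + 1) • z), _, hst, ?_⟩
        rw [show i + m + 1 = i + 1 + m by omega, pow_add p (i + 1) m]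
        simp only [add_smul, smul_sub, smul_add, one_smul, mul_smul]
        abel
      · left
        exact Set.mem_biUnion (x := x) ⟨hx, hr⟩ ⟨y, (hmem x n y).2 ha, 0, rfl, by rw [add_zero]⟩
  · obtain ⟨k, hk, hY⟩ := hpieces 1 R hRfin (fun x hx => hΩ V hV x hx) (by
      rintro x hx ⟨-, y, m, h⟩
      rw [pullback_pullback] at h
      exact hcyc ⟨1 + m, _, by omega, h⟩)
    refine ⟨k, hk, ?_⟩
    convert hY using 1
    ext a
    simp only [Set.mem_iUnion]
    constructor
    · intro ha
      obtain ⟨x, hx, y, rfl⟩ := hR a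
      exact ⟨x, hx, y, (hmem x 1 y).2 (by rwa [pow_one]), 0, rfl, by rw [pow_one, add_zero]⟩
    · rintro ⟨x, -, y, hy, c, hc, rfl⟩
      rw [AddSubgroup.mem_bot.1 hc, add_zero]
      exact (hmem x 1 y).1 hy

end Descent

section FrobeniusCoordinates

variable {L : Type*} [Field L] {p : ℕ}

/-- The functions `l j` are the `p`-th roots of the coordinates with respect to the basis `b` of
`L` over its subfield of `p`-th powers. -/
def IsFrobeniusCoord (p : ℕ) {J : Type*} [Fintype J] (b : J → L) (l : J → L → L) : Prop :=
  (∀ x, ∑ j, b j * l j x ^ p = x) ∧ ∀ y : J → L, ∑ j, b j * y j ^ p = 0 → ∀ j, y j = 0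

variable {J : Type*} [Fintype J] {b : J → L} {l : J → L → L}

lemma IsFrobeniusCoord.scale (h : IsFrobeniusCoord p b l) {z : L} (hz : z ≠ 0) :
    IsFrobeniusCoord p (fun j => b j * z⁻¹ ^ p) fun j x => z * l j x := by
  refine ⟨fun x => ?_, fun y hy j => ?_⟩
  · conv_rhs => rw [← h.1 x]
    refine sum_congr rfl fun j _ => ?_
    rw [mul_assoc, ← mul_pow, inv_mul_cancel_left₀ hz]
  · have := h.2 (fun j => z⁻¹ * y j) (by simpa only [mul_pow, ← mul_assoc] using hy) j
    simpa [hz] using this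

variable [Fact p.Prime] [CharP L p]

lemma exists_isFrobeniusCoord {G : Set L} (hG : G.Finite) (hGtop : Subfield.closure G = ⊤) :
    ∃ (n : ℕ) (b : Fin n → L) (l : Fin n → L → L), IsFrobeniusCoord p b l := by
  set M := (frobenius L p).fieldRange
  have : Finite G := hG
  have hfin : FiniteDimensional M (IntermediateField.adjoin M G) := by
    refine IntermediateField.finiteDimensional_adjoin fun x _ => ?_
    refine IsIntegral.of_pow (Fact.out : p.Prime).pos ?_
    exact isIntegral_algebraMap (R := M) (A := L) (x := ⟨x ^ p, x, rfl⟩)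
  have htop : IntermediateField.adjoin M G = ⊤ := by
    rw [eq_top_iff]
    intro x _
    have : Subfield.closure G ≤ (IntermediateField.adjoin M G).toSubfield :=
      Subfield.closure_le.2 (IntermediateField.subset_adjoin M G)
    exact this (hGtop ▸ Subfield.mem_top x)
  rw [htop] at hfin
  have hfin' : FiniteDimensional M L :=
    Module.Finite.equiv (IntermediateField.topEquiv (F := M) (E := L)).toLinearEquiv
  set B := Module.finBasis M L
  have hroot : ∀ m : M, ∃ y : L, y ^ p = m := fun m => m.2
  choose root hroot using hroot
  refine ⟨_, B, fun j x => root (B.repr x j), fun x => ?_, fun y hy j => ?_⟩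
  · conv_rhs => rw [← B.sum_repr x]
    refine sum_congr rfl fun j _ => ?_
    rw [hroot, mul_comm]
    rfl
  · have h := Fintype.linearIndependent_iff.1 B.linearIndependent
      (fun j => ⟨y j ^ p, y j, rfl⟩) (by
        rw [← hy]
        exact sum_congr rfl fun j _ => mul_comm _ _) j
    exact eq_zero_of_pow_eq_zero (congrArg Subtype.val h)

lemma IsFrobeniusCoord.map_add (h : IsFrobeniusCoord p b l) (j : J) (x y : L) :
    l j (x + y) = l j x + l j y := by
  have hp : ∀ u v : L, (u - v) ^ p = u ^ p - v ^ p := fun u v => sub_pow_char u v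
  have := h.2 (fun j => l j (x + y) - (l j x + l j y)) ?_ j
  · exact sub_eq_zero.1 this
  · simp only [hp, add_pow_char, mul_sub, mul_add, sum_sub_distrib, sum_add_distrib, h.1]
    ring

lemma IsFrobeniusCoord.map_pow_mul (h : IsFrobeniusCoord p b l) (j : J) (z x : L) :
    l j (z ^ p * x) = z * l j x := by
  have hp : ∀ u v : L, (u - v) ^ p = u ^ p - v ^ p := fun u v => sub_pow_char u v
  have := h.2 (fun j => l j (z ^ p * x) - z * l j x) ?_ j
  · exact sub_eq_zero.1 this
  · simp only [hp, mul_pow, mul_sub, sum_sub_distrib, h.1, mul_left_comm _ (z ^ p)]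
    rw [← mul_sum, h.1, sub_self]

lemma IsFrobeniusCoord.sum_mul_pow_eq_zero_iff (h : IsFrobeniusCoord p b l) {S : Type*} [Fintype S]
    (c v : S → L) : ∑ s, c s * v s ^ p = 0 ↔ ∀ j, ∑ s, l j (c s) * v s = 0 := by
  have hsum : ∑ s, c s * v s ^ p = ∑ j, b j * (∑ s, l j (c s) * v s) ^ p := by
    have hexp : ExpChar L p := ExpChar.prime Fact.out
    simp only [sum_pow_char, mul_sum, mul_pow]
    rw [sum_comm]
    refine sum_congr rfl fun s _ => ?_
    conv_lhs => rw [← h.1 (c s), sum_mul]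
    exact sum_congr rfl fun j _ => by ring
  rw [hsum]
  refine ⟨h.2 _, fun hj => ?_⟩
  simp [hj, (Fact.out : p.Prime).ne_zero]

end FrobeniusCoordinates

section Box

variable {L : Type*} [Field L]

/-- The monomial in the elements of `G` with exponents `a`. -/
def mon (G : Set L) [Fintype G] (a : G → ℕ) : L := ∏ i : G, (i : L) ^ a i

/-- The additive group generated by monomials in `G` whose exponents are at most `c`. -/
def box (G : Set L) [Fintype G] (c : ℕ) : AddSubgroup L :=
  AddSubgroup.closure (mon G '' Set.Iic fun _ => c)

variable {G : Set L} [Fintype G]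

lemma mon_add (a a' : G → ℕ) : mon G (a + a') = mon G a * mon G a' := by
  simp [mon, pow_add, prod_mul_distrib]

lemma mon_mem_box {c : ℕ} {a : G → ℕ} (h : ∀ i, a i ≤ c) : mon G a ∈ box G c :=
  AddSubgroup.subset_closure ⟨a, h, rfl⟩

lemma box_mono {c d : ℕ} (h : c ≤ d) : box G c ≤ box G d := by
  refine AddSubgroup.closure_mono (Set.image_mono ?_)
  exact Set.Iic_subset_Iic.2 fun _ => h

lemma mem_box_one (x : G) : (x : L) ∈ box G 1 := by
  classical
  have : mon G (Pi.single x 1) = x := by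
    rw [mon, prod_eq_single x] <;> simp +contextual
  rw [← this]
  refine mon_mem_box fun i => ?_
  rw [Pi.single_apply]
  split_ifs <;> omega

lemma one_mem_box : (1 : L) ∈ box G 0 := by
  have : mon G 0 = 1 := by simp [mon]
  rw [← this]
  exact mon_mem_box fun i => le_rfl

lemma mul_mem_box {c d : ℕ} {x y : L} (hx : x ∈ box G c) (hy : y ∈ box G d) :
    x * y ∈ box G (c + d) := by
  induction hx using AddSubgroup.closure_induction with
  | mem x hx =>
    obtain ⟨a, ha, rfl⟩ := hx
    induction hy using AddSubgroup.closure_induction with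
    | mem y hy =>
      obtain ⟨a', ha', rfl⟩ := hy
      rw [← mon_add]
      exact mon_mem_box fun i => add_le_add (ha i) (ha' i)
    | zero => simp
    | add _ _ _ _ h h' => rw [mul_add]; exact add_mem h h'
    | neg _ _ h => rw [mul_neg]; exact neg_mem h
  | zero => simp
  | add _ _ _ _ h h' => rw [add_mul]; exact add_mem h h'
  | neg _ _ h => rw [neg_mul]; exact neg_mem h

lemma exists_mem_box {x : L} (hx : x ∈ Subring.closure G) : ∃ c, x ∈ box G c := by
  induction hx using Subring.closure_induction with
  | mem x hx => exact ⟨1, mem_box_one ⟨x, hx⟩⟩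
  | zero => exact ⟨0, zero_mem _⟩
  | one => exact ⟨0, one_mem_box⟩
  | add x y _ _ h h' =>
    obtain ⟨⟨c, hc⟩, d, hd⟩ := And.intro h h'
    exact ⟨max c d, add_mem (box_mono (le_max_left c d) hc) (box_mono (le_max_right c d) hd)⟩
  | neg x _ h => exact h.imp fun c hc => neg_mem hc
  | mul x y _ _ h h' =>
    obtain ⟨⟨c, hc⟩, d, hd⟩ := And.intro h h'
    exact ⟨c + d, mul_mem_box hc hd⟩

lemma finite_box (p : ℕ) [Fact p.Prime] [CharP L p] (c : ℕ) : (box G c : Set L).Finite := by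
  classical
  let _ := ZMod.algebra L p
  have hfg : (Submodule.span (ZMod p) (mon G '' Set.Iic fun _ => c)).FG :=
    Submodule.fg_span ((Set.finite_Iic _).image _)
  have : Module.Finite (ZMod p) (Submodule.span (ZMod p) (mon G '' Set.Iic fun _ => c)) :=
    Module.Finite.iff_fg.2 hfg
  have hfin : Finite (Submodule.span (ZMod p) (mon G '' Set.Iic fun _ => c)) :=
    Module.finite_of_finite (ZMod p)
  refine Set.Finite.subset (Set.toFinite
    (Submodule.span (ZMod p) (mon G '' Set.Iic fun _ => c) : Set L)) ?_
  exact (AddSubgroup.closure_le (Submodule.span (ZMod p)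
    (mon G '' Set.Iic fun _ => c)).toAddSubgroup).2 Submodule.subset_span

lemma exists_common_denominator {G : Set L} (hG : Subfield.closure G = ⊤) {Z : Set L}
    (hZ : Z.Finite) : ∃ h ∈ Subring.closure G, h ≠ 0 ∧ ∀ z ∈ Z, h * z ∈ Subring.closure G := by
  induction Z, hZ using Set.Finite.induction_on with
  | empty => exact ⟨1, one_mem _, one_ne_zero, by simp⟩
  | @insert z Z _ _ ih =>
    obtain ⟨h, hh, h0, hZ⟩ := ih
    obtain ⟨x, hx, y, hy, hxy⟩ := Subfield.mem_closure_iff.1 (hG ▸ Subfield.mem_top z)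
    rcases eq_or_ne y 0 with rfl | hy0
    · refine ⟨h, hh, h0, ?_⟩
      rintro w (rfl | hw)
      · simp [← hxy]
      · exact hZ w hw
    · refine ⟨h * y, mul_mem hh hy, mul_ne_zero h0 hy0, ?_⟩
      rintro w (rfl | hw)
      · rw [← hxy, mul_assoc, mul_div_cancel₀ _ hy0]
        exact mul_mem hh hx
      · rw [mul_right_comm]
        exact mul_mem (hZ w hw) hy

variable {p : ℕ} [Fact p.Prime] [CharP L p]

lemma IsFrobeniusCoord.mem_box {J : Type*} [Fintype J] {b : J → L} {l : J → L → L}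
    (h : IsFrobeniusCoord p b l) {c : ℕ} (hc : ∀ j, ∀ a : G → Fin p,
      l j (mon G fun i => a i) ∈ box G c) (j : J) {d : ℕ} {x : L} (hx : x ∈ box G d) :
    l j x ∈ box G (c + d / p) := by
  let f : L →+ L := AddMonoidHom.mk' (l j) (h.map_add j)
  have hle : box G d ≤ (box G (c + d / p)).comap f := by
    rw [box, AddSubgroup.closure_le]
    rintro _ ⟨a, ha, rfl⟩
    have hsplit : mon G a = mon G (fun i => a i / p) ^ p * mon G (fun i => a i % p) := by
      simp only [mon, ← prod_pow, ← prod_mul_distrib, ← pow_mul, ← pow_add, mul_comm _ p,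
        Nat.div_add_mod]
    change l j (mon G a) ∈ box G (c + d / p)
    rw [hsplit, h.map_pow_mul, add_comm c]
    exact mul_mem_box (mon_mem_box fun i => Nat.div_le_div_right (ha i))
      (hc j fun i => ⟨a i % p, Nat.mod_lt _ (Fact.out : p.Prime).pos⟩)
  exact hle hx

/-- In a finitely generated field of characteristic `p`, finitely many elements lie in a finite
set stable under multiplication by given elements followed by Frobenius coordinates. -/
lemma exists_finite_stable_under_coord {G T U : Set L} (hG : G.Finite)
    (hGtop : Subfield.closure G = ⊤) (hT : T.Finite) (hU : U.Finite) :
    ∃ (n : ℕ) (b : Fin n → L) (l : Fin n → L → L) (E : Set L), IsFrobeniusCoord p b l ∧ E.Finite ∧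
      T ⊆ E ∧ ∀ u ∈ U, ∀ e ∈ E, ∀ j, l j (u * e) ∈ E := by
  classical
  obtain ⟨n, b, l, hbl⟩ := exists_isFrobeniusCoord (p := p) hG hGtop
  set H := G ∪ T ∪ U
  have : Fintype H := ((hG.union hT).union hU).fintype
  have hHtop : Subfield.closure H = ⊤ := by
    rw [eq_top_iff, ← hGtop]
    exact Subfield.closure_mono fun x hx => Or.inl (Or.inl hx)
  obtain ⟨h, -, h0, hh⟩ := exists_common_denominator hHtop
    (Set.finite_range fun ja : Fin n × (H → Fin p) => l ja.1 (mon H fun i => ja.2 i))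
  have hc : ∀ ja : Fin n × (H → Fin p), ∃ c, h * l ja.1 (mon H fun i => ja.2 i) ∈ box H c :=
    fun ja => exists_mem_box (hh _ ⟨ja, rfl⟩)
  choose c hc using hc
  set C := univ.sup c
  have hbl' := hbl.scale h0
  refine ⟨n, _, _, box H (2 * C + 1), hbl', finite_box p _, fun x hx => ?_, fun u hu e he j => ?_⟩
  · exact box_mono (by omega) (mem_box_one ⟨x, Or.inl (Or.inr hx)⟩)
  · have hue := mul_mem_box (mem_box_one (G := H) ⟨u, Or.inr hu⟩) he
    refine box_mono ?_ (hbl'.mem_box (c := C) (fun j a => ?_) j hue)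
    · have := Nat.div_le_div_left (a := 1 + (2 * C + 1)) (Fact.out : p.Prime).two_le two_pos
      omega
    · exact box_mono (le_sup (mem_univ (j, a))) (hc (j, a))

end Box

section LinearEquations

variable {L : Type*} [Field L]

/-- The common zeros of the linear forms with coefficient vectors in `D`. -/
def zeros {S : Type*} [Fintype S] (D : Set (S → L)) : Submodule L (S → L) where
  carrier := {v | ∀ d ∈ D, ∑ s, d s * v s = 0}
  zero_mem' := by simp
  add_mem' hv hw d hd := by simp [mul_add, sum_add_distrib, hv d hd, hw d hd]
  smul_mem' c v hv d hd := by simp [mul_left_comm _ c, ← mul_sum, hv d hd]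

lemma mem_zeros {S : Type*} [Fintype S] {D : Set (S → L)} {v : S → L} :
    v ∈ zeros D ↔ ∀ d ∈ D, ∑ s, d s * v s = 0 := Iff.rfl

lemma exists_finite_representatives {A : Type*} [AddCommGroup A] [Module.Finite ℤ A] {p : ℕ}
    (hp : p ≠ 0) : ∃ R : Set A, R.Finite ∧ ∀ a : A, ∃ x ∈ R, ∃ y, a = x + p • y := by
  set P : AddSubgroup A := (nsmulAddMonoidHom p).range
  have hfin : Module.Finite ℤ (A ⧸ P) :=
    Module.Finite.of_surjective (QuotientAddGroup.mk' P).toIntLinearMap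
      (QuotientAddGroup.mk'_surjective P)
  have htors : Module.IsTorsion ℤ (A ⧸ P) := by
    intro z
    refine ⟨⟨p, mem_nonZeroDivisors_of_ne_zero (by exact_mod_cast hp)⟩, ?_⟩
    obtain ⟨a, rfl⟩ := QuotientAddGroup.mk_surjective z
    change (p : ℤ) • (a : A ⧸ P) = 0
    rw [natCast_zsmul, ← QuotientAddGroup.mk_nsmul, QuotientAddGroup.eq_zero_iff]
    exact ⟨a, rfl⟩
  have : Finite (A ⧸ P) := Module.finite_of_fg_torsion _ htors
  refine ⟨Set.range (Quotient.out : A ⧸ P → A), Set.finite_range _, fun a => ?_⟩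
  have h : (((a : A ⧸ P).out : A) : A ⧸ P) = a := QuotientAddGroup.out_eq' _
  obtain ⟨y, hy⟩ := QuotientAddGroup.eq.1 h
  refine ⟨_, ⟨(a : A ⧸ P), rfl⟩, y, ?_⟩
  rw [nsmulAddMonoidHom_apply] at hy
  rw [hy, add_neg_cancel_left]

/-- Solutions of linear equations in a finitely generated multiplicative group over a finitely
generated field of characteristic `p` form a finite union of `F`-sets. -/
theorem exists_isFSetUnion_linear_equations {p : ℕ} [Fact p.Prime] [CharP L p] {G : Set L}
    (hG : G.Finite) (hGtop : Subfield.closure G = ⊤) {S : Type*} [Fintype S] {A : Type*}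
    [AddCommGroup A] [Module.Finite ℤ A] (χ : AddChar A (S → L)) {D : Set (S → L)}
    (hD : D.Finite) :
    ∃ k, 1 ≤ k ∧ IsFSetUnion (p ^ k) {a | ∀ d ∈ D, ∑ s, d s * χ a s = 0} := by
  obtain ⟨R, hRfin, hR⟩ := exists_finite_representatives (A := A) (Fact.out : p.Prime).ne_zero
  obtain ⟨n, b, l, E, hbl, hE, hDE, hlE⟩ := exists_finite_stable_under_coord (p := p) hG hGtop
    (hD.biUnion fun d _ => Set.finite_range d) (hRfin.biUnion fun x _ => Set.finite_range (χ x))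
  set Ω : Set (Submodule L (S → L)) := zeros '' 𝒫 (Set.univ.pi fun _ : S => E)
  have hΩfin : Ω.Finite := ((Set.Finite.pi fun _ => hE).finite_subsets).image _
  refine exists_isFSetUnion_of_finite_pullbacks hΩfin hRfin hR ?_ (zeros D) ⟨D, ?_, rfl⟩
  · rintro _ ⟨D', hD', rfl⟩ x hx
    refine ⟨{d' | ∃ d ∈ D', ∃ j, d' = fun s => l j (χ x s * d s)}, ?_, ?_⟩
    · rintro _ ⟨d, hd, j, rfl⟩ s -
      exact hlE _ (Set.mem_biUnion hx ⟨s, rfl⟩) _ (hD' hd s trivial) j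
    · ext v
      rw [mem_pullback, mem_zeros, mem_zeros]
      have h : ∀ d : S → L, ∑ s, d s * (χ x * v ^ p ^ 1) s = 0 ↔
          ∀ j, ∑ s, l j (χ x s * d s) * v s = 0 := by
        intro d
        rw [← hbl.sum_mul_pow_eq_zero_iff (fun s => χ x s * d s) v]
        have hs : ∀ s, d s * (χ x * v ^ p ^ 1) s = χ x s * d s * v s ^ p := fun s => by
          simp only [Pi.mul_apply, Pi.pow_apply, pow_one]
          ring
        simp only [hs]
      simp only [h]
      constructor
      · intro h d hd j
        exact h _ ⟨d, hd, j, rfl⟩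
      · rintro h _ ⟨d, hd, j, rfl⟩
        exact h d hd j
  · exact fun d hd s _ => hDE (Set.mem_biUnion hd ⟨s, rfl⟩)

end LinearEquations

section Torus

variable {K : Type*} [Field K]

lemma exists_units_pow_eq [IsAlgClosed K] {ι : Type*} (g : ι → Kˣ) {n : ℕ} (hn : 0 < n) :
    ∃ α : ι → Kˣ, α ^ n = g := by
  have : ∀ i, ∃ z : Kˣ, z ^ n = g i := by
    intro i
    obtain ⟨z, hz⟩ := IsAlgClosed.exists_pow_nat_eq (g i : K) hn
    have hz0 : z ≠ 0 := by
      rintro rfl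
      rw [zero_pow hn.ne'] at hz
      exact (g i).ne_zero hz.symm
    exact ⟨Units.mk0 z hz0, Units.ext (by simpa using hz)⟩
  choose α hα using this
  exact ⟨α, funext hα⟩

lemma mulFSetIn_of_isFSet [IsAlgClosed K] {q : ℕ} (hq : 2 ≤ q) {k : ℕ} (hk : 1 ≤ k) {ι : Type*}
    {Γ : Subgroup (ι → Kˣ)} {Z : Set (Additive Γ)} (hZ : IsFSet (q ^ k) Z) :
    MulFSetIn q Γ ((fun a : Additive Γ => (a.toMul : ι → Kˣ)) '' Z) := by
  obtain ⟨r, a, g, B, rfl⟩ := hZ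
  have hQ : 2 ≤ q ^ k := le_trans hq (Nat.le_self_pow (by omega) q)
  have hroot := fun i => exists_units_pow_eq ((g i).toMul : ι → Kˣ) (n := q ^ k - 1) (by omega)
  choose α hα using hroot
  have hpow : ∀ i n, α i ^ q ^ (k * n) = ((g i).toMul : ι → Kˣ) ^ geom (q ^ k) n * α i := by
    intro i n
    have h : (q ^ k) ^ n = (q ^ k - 1) * geom (q ^ k) n + 1 := by
      have := sub_one_mul_geom (q ^ k) n
      zify [show 1 ≤ q ^ k by omega]
      push_cast at this
      linarith
    rw [← hα, ← pow_mul, ← pow_succ, pow_mul q, h]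
  have hval : ∀ n : Fin r → ℕ, ((a.toMul : ι → Kˣ) * ∏ i, (α i)⁻¹) * ∏ i, α i ^ q ^ (k * n i)
      = (((a + ∑ i, geom (q ^ k) (n i) • g i).toMul : Γ) : ι → Kˣ) := by
    intro n
    simp only [hpow, prod_mul_distrib, prod_inv_distrib]
    simp only [toMul_add, toMul_sum, toMul_nsmul, Subgroup.coe_mul, Subgroup.val_finsetProd,
      Subgroup.coe_pow]
    rw [mul_assoc, mul_comm (∏ i, _ ^ _), inv_mul_cancel_left]
  refine ⟨_, (AddSubgroup.toSubgroup' B).map Γ.subtype,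
    ⟨r, (a.toMul : ι → Kˣ) * ∏ i, (α i)⁻¹, α, fun _ => k, fun _ => hk, rfl⟩, ?_, ?_, ?_⟩
  · rintro _ ⟨n, rfl⟩
    rw [hval]
    exact Subtype.property _
  · exact Subgroup.map_subtype_le _
  · ext x
    rw [Set.mem_mul]
    constructor
    · rintro ⟨_, ⟨n, b, hb, rfl⟩, rfl⟩
      exact ⟨_, ⟨n, rfl⟩, _, ⟨b.toMul, hb, rfl⟩, by rw [hval]; rfl⟩
    · rintro ⟨_, ⟨n, rfl⟩, _, ⟨b, hb, rfl⟩, rfl⟩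
      exact ⟨_, ⟨n, Additive.ofMul b, hb, rfl⟩, by rw [hval]; rfl⟩

/-- The character of `Γ` given by evaluating monomials, over a subfield containing all
coordinates. -/
def monomialChar {ι : Type*} [Fintype ι] {Γ : Subgroup (ι → Kˣ)} {L : Subfield K}
    (hL : ∀ γ ∈ Γ, ∀ i, (γ i : K) ∈ L) {S : Type*} (e : S → ι → ℕ) :
    AddChar (Additive Γ) (S → L) where
  toFun a s := ∏ i, (⟨(a.toMul : ι → Kˣ) i, hL _ a.toMul.2 i⟩ : L) ^ e s i
  map_zero_eq_one' := by
    ext s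
    simp
  map_add_eq_mul' a b := by
    ext s
    simp [mul_pow, prod_mul_distrib]

end Torus

end MoosaScanlon

open MoosaScanlon in
/-- **Theorem (Moosa–Scanlon, for algebraic tori).** Let `K` be an algebraically closed
field of characteristic `p > 0`, `q = p^e` a power of `p`, `N ≥ 1`, `X ⊆ K^N` the zero
locus of a set of polynomials, and `Γ` a finitely generated subgroup of `(K^×)^N` which
is mapped into itself by `F^ℓ` for some `ℓ ≥ 1`, where `F : γ ↦ γ^q` is the `q`-power
map. Then `{γ ∈ Γ : γ ∈ X}` is a finite union of multiplicative `F`-sets in `Γ`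
(based in `(K^×)^N`). -/
theorem moosa_scanlon_torus {K : Type*} [Field K] [IsAlgClosed K]
    (p : ℕ) [Fact (Nat.Prime p)] [CharP K p]
    (q : ℕ) (hq : ∃ e : ℕ, 1 ≤ e ∧ q = p ^ e)
    (N : ℕ) (hN : 1 ≤ N)
    (polys : Set (MvPolynomial (Fin N) K))
    (Γ : Subgroup (Fin N → Kˣ)) (hΓ : Γ.FG)
    (ℓ : ℕ) (hℓ : 1 ≤ ℓ)
    (hinv : ∀ γ ∈ Γ, (fun i => γ i ^ (q ^ ℓ)) ∈ Γ) :
    ∃ (k : ℕ) (Fs : Fin k → Set (Fin N → Kˣ)),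
      (∀ i, MulFSetIn q Γ (Fs i)) ∧
      {γ : Fin N → Kˣ | γ ∈ Γ ∧ ∀ f ∈ polys, MvPolynomial.eval (fun i => (γ i : K)) f = 0}
        = ⋃ i, Fs i := by
  classical
  obtain ⟨e, he, rfl⟩ := hq
  have hp : p.Prime := Fact.out
  obtain ⟨P, hPsub, hPspan⟩ := (Submodule.fg_span_iff_fg_span_finset_subset polys).1
    (IsNoetherian.noetherian (Ideal.span polys))
  have hzero : ∀ x : Fin N → K, (∀ f ∈ polys, MvPolynomial.eval x f = 0) ↔
      ∀ f ∈ P, MvPolynomial.eval x f = 0 := by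
    intro x
    refine ⟨fun h f hf => h f (hPsub hf), fun h f hf => ?_⟩
    have hle : Ideal.span (P : Set (MvPolynomial (Fin N) K)) ≤ RingHom.ker (MvPolynomial.eval x) :=
      Ideal.span_le.2 h
    refine hle ?_
    change f ∈ Submodule.span _ _
    rw [← hPspan]
    exact Submodule.subset_span hf
  obtain ⟨gens, hgens⟩ := hΓ
  set M : Finset (Fin N →₀ ℕ) := P.biUnion MvPolynomial.support
  set G : Set K := (⋃ γ ∈ gens, Set.range fun i => (γ i : K)) ∪
    ⋃ f ∈ P, (fun m => MvPolynomial.coeff m f) '' M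
  have hGfin : G.Finite := (gens.finite_toSet.biUnion fun γ _ => Set.finite_range _).union
    (P.finite_toSet.biUnion fun f _ => M.finite_toSet.image _)
  set L := Subfield.closure G
  have hL : ∀ γ ∈ Γ, ∀ i, (γ i : K) ∈ L := by
    intro γ hγ
    rw [← hgens] at hγ
    induction hγ using Subgroup.closure_induction with
    | mem γ hγ =>
      exact fun i => Subfield.subset_closure (Or.inl (Set.mem_biUnion hγ ⟨i, rfl⟩))
    | one => exact fun i => by simp
    | mul γ γ' _ _ h h' => exact fun i => by simpa using mul_mem (h i) (h' i)
    | inv γ _ h => exact fun i => by simpa using inv_mem (h i)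
  have hcoeff : ∀ f ∈ P, ∀ m ∈ M, MvPolynomial.coeff m f ∈ L := fun f hf m hm =>
    Subfield.subset_closure (Or.inr (Set.mem_biUnion hf ⟨m, hm, rfl⟩))
  have hLtop : Subfield.closure (Subtype.val ⁻¹' G : Set L) = ⊤ := by
    rw [eq_top_iff]
    have hle : L ≤ (Subfield.closure (Subtype.val ⁻¹' G : Set L)).map L.subtype :=
      Subfield.closure_le.2 fun x hx =>
        ⟨⟨x, Subfield.subset_closure hx⟩, Subfield.subset_closure hx, rfl⟩
    intro x _
    obtain ⟨y, hy, hyx⟩ := hle x.2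
    rwa [← Subtype.ext hyx]
  have hfg : Module.Finite ℤ (Additive Γ) := by
    rw [Module.Finite.iff_addGroup_fg, ← GroupFG.iff_add_fg, Group.fg_iff_subgroup_fg]
    exact ⟨gens, hgens⟩
  set χ := monomialChar hL fun (m : M) => ⇑(m : Fin N →₀ ℕ)
  set D : Set (M → L) := Set.range fun f : P => fun m => ⟨_, hcoeff f f.2 m m.2⟩
  obtain ⟨k, hk, hX⟩ := exists_isFSetUnion_linear_equations (p := p)
    (hGfin.preimage Subtype.val_injective.injOn) hLtop χ (Set.finite_range _ : D.Finite)
  obtain ⟨F, hF, hFs, hXF⟩ := hX.refine he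
  rw [← pow_mul, mul_comm, pow_mul] at hFs
  have hmem : ∀ γ : Γ, (∀ f ∈ polys, MvPolynomial.eval (fun i => ((γ : Fin N → Kˣ) i : K)) f = 0) ↔
      Additive.ofMul γ ∈ ⋃₀ F := by
    intro γ
    rw [hzero, ← hXF]
    have h : ∀ f : P, ((∑ m : M, (⟨_, hcoeff f f.2 m m.2⟩ : L) * χ (Additive.ofMul γ) m : L) : K)
        = MvPolynomial.eval (fun i => ((γ : Fin N → Kˣ) i : K)) f := by
      intro f
      rw [MvPolynomial.eval_eq', Finset.sum_subset (Finset.subset_biUnion_of_mem _ f.2)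
        fun m _ hm => by rw [MvPolynomial.notMem_support_iff.1 hm, zero_mul],
        ← Finset.sum_coe_sort M]
      push_cast
      refine Finset.sum_congr rfl fun m _ => ?_
      congr 1
      change ((∏ i, _ : L) : K) = _
      push_cast
      rfl
    constructor
    · rintro hγ _ ⟨f, rfl⟩
      exact Subtype.ext ((h f).trans (hγ f f.2))
    · intro hγ f hf
      rw [← h ⟨f, hf⟩]
      exact congrArg Subtype.val (hγ _ ⟨⟨f, hf⟩, rfl⟩)
  obtain ⟨n, ⟨φ⟩⟩ := @Finite.exists_equiv_fin F hF
  have hq2 : 2 ≤ p ^ e := le_trans hp.two_le (Nat.le_self_pow (by omega) p)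
  refine ⟨n, fun i => (fun a : Additive Γ => (a.toMul : Fin N → Kˣ)) '' (φ.symm i : Set _),
    fun i => mulFSetIn_of_isFSet hq2 hk (hFs _ (φ.symm i).2), ?_⟩
  ext γ
  simp only [Set.mem_iUnion]
  constructor
  · rintro ⟨hγ, h⟩
    obtain ⟨Y, hY, hγY⟩ := (hmem ⟨γ, hγ⟩).1 h
    exact ⟨φ ⟨Y, hY⟩, _, by rwa [Equiv.symm_apply_apply], rfl⟩
  · rintro ⟨i, a, ha, rfl⟩
    exact ⟨a.toMul.2, (hmem a.toMul).2 ⟨_, (φ.symm i).2, ha⟩⟩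
end
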